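/- arXiv:math/0206214 — 2 statements merged into one kernel-verified Lean document; each statement's English description precedes it below -/
import Mathlib

section
/- Let a, b ∈ 𝔻 be distinct. Then for every z ∈ 𝔻², limsup_{ε→0, ε≠0} L^ε_{aVbV}(z) ≤ min{ L_{a0b0}(z), L_{aVb0}(z), L_{a0bV}(z), L_{aVbV}(z) }, where the limsup is over complex ε ≠ 0 tending to 0. -/
open Complex Metric Filter Topology

noncomputable section

/-- The open unit disc in `ℂ`. -/
def unitDisc : Set ℂ := Metric.ball 0 1

/-- Extended-real logarithm, with the convention `log 0 = ⊥`. -/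
def elog (x : ℝ) : EReal := if x = 0 then ⊥ else ((Real.log x : ℝ) : EReal)

/-- The Möbius involution of the unit disc exchanging `ξ` and `0`. -/
def mobius (ξ ζ : ℂ) : ℂ := (ξ - ζ) / (1 - (starRingEnd ℂ) ξ * ζ)

/-- An analytic disc in the bidisc `𝔻²`, given by its two components. -/
def AnalyticDisc2 (φ₁ φ₂ : ℂ → ℂ) : Prop :=
  DifferentiableOn ℂ φ₁ unitDisc ∧ DifferentiableOn ℂ φ₂ unitDisc ∧
  (∀ w ∈ unitDisc, φ₁ w ∈ unitDisc) ∧ (∀ w ∈ unitDisc, φ₂ w ∈ unitDisc)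

/-- The Lempert function with the two simple poles `(a,0)`, `(b,0)` in the bidisc. -/
def La0b0 (a b : ℂ) (z : ℂ × ℂ) : EReal :=
  sInf { t : EReal | ∃ (φ₁ φ₂ : ℂ → ℂ) (ζ₁ ζ₂ : ℂ),
    AnalyticDisc2 φ₁ φ₂ ∧ ζ₁ ∈ unitDisc ∧ ζ₂ ∈ unitDisc ∧
    φ₁ 0 = z.1 ∧ φ₂ 0 = z.2 ∧
    φ₁ ζ₁ = a ∧ φ₂ ζ₁ = 0 ∧ φ₁ ζ₂ = b ∧ φ₂ ζ₂ = 0 ∧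
    t = elog (‖ζ₁‖) + elog (‖ζ₂‖) }

/-- The generalized Lempert function with vertical indicator at `(a,0)` and
simple pole `(b,0)`. -/
def LaVb0 (a b : ℂ) (z : ℂ × ℂ) : EReal :=
  sInf { t : EReal | ∃ (φ₁ φ₂ : ℂ → ℂ) (ζ₁ ζ₂ : ℂ),
    AnalyticDisc2 φ₁ φ₂ ∧ ζ₁ ∈ unitDisc ∧ ζ₂ ∈ unitDisc ∧
    φ₁ 0 = z.1 ∧ φ₂ 0 = z.2 ∧
    φ₁ ζ₁ = a ∧ φ₂ ζ₁ = 0 ∧ φ₁ ζ₂ = b ∧ φ₂ ζ₂ = 0 ∧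
    deriv φ₁ ζ₁ = 0 ∧
    t = elog (‖ζ₁‖) + elog (‖ζ₁‖) + elog (‖ζ₂‖) }

/-- The generalized Lempert function with simple pole `(a,0)` and vertical
indicator at `(b,0)`. -/
def La0bV (a b : ℂ) (z : ℂ × ℂ) : EReal :=
  sInf { t : EReal | ∃ (φ₁ φ₂ : ℂ → ℂ) (ζ₁ ζ₂ : ℂ),
    AnalyticDisc2 φ₁ φ₂ ∧ ζ₁ ∈ unitDisc ∧ ζ₂ ∈ unitDisc ∧
    φ₁ 0 = z.1 ∧ φ₂ 0 = z.2 ∧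
    φ₁ ζ₁ = a ∧ φ₂ ζ₁ = 0 ∧ φ₁ ζ₂ = b ∧ φ₂ ζ₂ = 0 ∧
    deriv φ₁ ζ₂ = 0 ∧
    t = elog (‖ζ₁‖) + elog (‖ζ₂‖) + elog (‖ζ₂‖) }

/-- The generalized Lempert function with vertical indicators at `(a,0)` and `(b,0)`. -/
def LaVbV (a b : ℂ) (z : ℂ × ℂ) : EReal :=
  sInf { t : EReal | ∃ (φ₁ φ₂ : ℂ → ℂ) (ζ₁ ζ₂ : ℂ),
    AnalyticDisc2 φ₁ φ₂ ∧ ζ₁ ∈ unitDisc ∧ ζ₂ ∈ unitDisc ∧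
    φ₁ 0 = z.1 ∧ φ₂ 0 = z.2 ∧
    φ₁ ζ₁ = a ∧ φ₂ ζ₁ = 0 ∧ φ₁ ζ₂ = b ∧ φ₂ ζ₂ = 0 ∧
    deriv φ₁ ζ₁ = 0 ∧ deriv φ₁ ζ₂ = 0 ∧
    t = elog (‖ζ₁‖) + elog (‖ζ₁‖)
        + elog (‖ζ₂‖) + elog (‖ζ₂‖) }

/-- Coman's Lempert function with the three simple poles `(a,0)`, `(b,0)`, `(b,ε)`. -/
def Leps3 (a b ε : ℂ) (z : ℂ × ℂ) : EReal :=
  sInf { t : EReal | ∃ (φ₁ φ₂ : ℂ → ℂ) (ζ₁ ζ₂ ζ₃ : ℂ),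
    AnalyticDisc2 φ₁ φ₂ ∧ ζ₁ ∈ unitDisc ∧ ζ₂ ∈ unitDisc ∧ ζ₃ ∈ unitDisc ∧
    φ₁ 0 = z.1 ∧ φ₂ 0 = z.2 ∧
    φ₁ ζ₁ = a ∧ φ₂ ζ₁ = 0 ∧ φ₁ ζ₂ = b ∧ φ₂ ζ₂ = 0 ∧ φ₁ ζ₃ = b ∧ φ₂ ζ₃ = ε ∧
    t = elog (‖ζ₁‖) + elog (‖ζ₂‖) + elog (‖ζ₃‖) }

/-- Coman's Lempert function with the four simple poles
`(a,0)`, `(b,0)`, `(b,ε)`, `(a,ε)`. -/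
def Leps4 (a b ε : ℂ) (z : ℂ × ℂ) : EReal :=
  sInf { t : EReal | ∃ (φ₁ φ₂ : ℂ → ℂ) (ζ₁ ζ₂ ζ₃ ζ₄ : ℂ),
    AnalyticDisc2 φ₁ φ₂ ∧ ζ₁ ∈ unitDisc ∧ ζ₂ ∈ unitDisc ∧ ζ₃ ∈ unitDisc ∧ ζ₄ ∈ unitDisc ∧
    φ₁ 0 = z.1 ∧ φ₂ 0 = z.2 ∧
    φ₁ ζ₁ = a ∧ φ₂ ζ₁ = 0 ∧ φ₁ ζ₂ = b ∧ φ₂ ζ₂ = 0 ∧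
    φ₁ ζ₃ = b ∧ φ₂ ζ₃ = ε ∧ φ₁ ζ₄ = a ∧ φ₂ ζ₄ = ε ∧
    t = elog (‖ζ₁‖) + elog (‖ζ₂‖)
        + elog (‖ζ₃‖) + elog (‖ζ₄‖) }

/-- Strictly bounded holomorphic function on the disc. -/
def StrictDisc (f : ℂ → ℂ) : Prop :=
  DifferentiableOn ℂ f unitDisc ∧ ∃ ρ : ℝ, ρ < 1 ∧ ∀ w ∈ unitDisc, ‖f w‖ ≤ ρ

lemma mem_unitDisc {w : ℂ} : w ∈ unitDisc ↔ ‖w‖ < 1 := by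
  simp [unitDisc]

lemma StrictDisc.maps {f : ℂ → ℂ} (h : StrictDisc f) : ∀ w ∈ unitDisc, f w ∈ unitDisc := by
  obtain ⟨_, ρ, h1, h2⟩ := h
  intro w hw
  exact mem_unitDisc.2 ((h2 w hw).trans_lt h1)

lemma StrictDisc.shrink {f : ℂ → ℂ} (hf : DifferentiableOn ℂ f unitDisc)
    (hm : ∀ w ∈ unitDisc, f w ∈ unitDisc) {r : ℝ} (h0 : 0 < r) (h1 : r < 1) :
    StrictDisc (fun w => f (r * w)) := by
  have hmap : ∀ w ∈ unitDisc, (r : ℂ) * w ∈ closedBall (0 : ℂ) r := by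
    intro w hw
    rw [mem_unitDisc] at hw
    simp only [mem_closedBall, dist_zero_right, norm_mul, Complex.norm_real, Real.norm_eq_abs,
      abs_of_pos h0]
    nlinarith
  have hsub : closedBall (0 : ℂ) r ⊆ unitDisc := by
    intro w hw
    rw [mem_unitDisc]
    simp at hw
    linarith
  refine ⟨hf.comp (by fun_prop) (fun w hw => hsub (hmap w hw)), ?_⟩
  obtain ⟨x, hx, hmax⟩ := (isCompact_closedBall (0 : ℂ) r).exists_isMaxOn
    ⟨0, by simp [h0.le]⟩ ((hf.continuousOn.mono hsub).norm)
  refine ⟨‖f x‖, mem_unitDisc.1 (hm x (hsub hx)), fun w hw => hmax (hmap w hw)⟩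

lemma exp_aux (c : ℝ) (hc : 0 ≤ c) (X : ℂ) (h1 : X.re ≤ c) (h2 : |X.im| ≤ c) :
    ‖cexp X‖ + ‖1 - cexp X‖ ≤ 2 * Real.exp c - 1 + Real.exp c * c := by
  have e1 : ‖cexp X‖ = Real.exp X.re := Complex.norm_exp X
  have e2 : 1 - cexp X = ((1 - Real.exp X.re : ℝ) : ℂ)
      - (Real.exp X.re : ℝ) * (cexp (I * X.im) - 1) := by
    conv_lhs => rw [← Complex.re_add_im X, Complex.exp_add]
    push_cast
    rw [mul_comm I]
    ring
  have e3 : ‖cexp (I * X.im) - 1‖ ≤ |X.im| := by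
    simpa using Real.norm_exp_I_mul_ofReal_sub_one_le (x := X.im)
  have e4 : ‖1 - cexp X‖ ≤ |1 - Real.exp X.re| + Real.exp X.re * |X.im| := by
    rw [e2]
    refine (norm_sub_le _ _).trans ?_
    rw [norm_mul, Complex.norm_real, Complex.norm_real, Real.norm_eq_abs, Real.norm_eq_abs,
      abs_of_pos (Real.exp_pos _)]
    have := Real.exp_pos X.re
    gcongr
  have e5 : Real.exp X.re ≤ Real.exp c := Real.exp_le_exp.2 h1
  have e6 : 1 ≤ Real.exp c := Real.one_le_exp hc
  have e7 : Real.exp X.re * |X.im| ≤ Real.exp c * c :=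
    mul_le_mul e5 h2 (abs_nonneg _) (Real.exp_pos _).le
  rw [e1]
  rcases abs_cases (1 - Real.exp X.re) with ⟨h, _⟩ | ⟨h, _⟩ <;> rw [h] at e4 <;> linarith

lemma half_facts {ζ : ℂ} (h : ζ ∈ unitDisc) :
    0 < ((1 - ζ) / 2).re ∧ ‖(1 - ζ) / 2‖ ≤ 1 ∧ 0 < ‖(1 - ζ) / 2‖ := by
  rw [mem_unitDisc] at h
  have h1 : ζ.re < 1 := (Complex.re_le_norm ζ).trans_lt h
  have h2 : 0 < ((1 - ζ) / 2).re := by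
    have : ((1 - ζ) / 2).re = (1 - ζ.re) / 2 := by simp
    rw [this]; linarith
  refine ⟨h2, ?_, ?_⟩
  · rw [norm_div]
    have := norm_sub_le (1 : ℂ) ζ
    simp at this ⊢
    linarith
  · refine norm_pos_iff.2 fun h0 => ?_
    rw [h0] at h2
    simp at h2

lemma log_aux {u : ℂ} (h2 : ‖u‖ ≤ 1) (h3 : 0 < ‖u‖) :
    ‖u‖ * ‖Complex.log u‖ ≤ 1 + Real.pi ∧ |(Complex.log u).im| ≤ Real.pi := by
  have him : |(Complex.log u).im| ≤ Real.pi := by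
    rw [Complex.log_im]; exact Complex.abs_arg_le_pi u
  refine ⟨?_, him⟩
  have hn : ‖Complex.log u‖ ≤ |Real.log ‖u‖| + Real.pi := by
    refine (Complex.norm_le_abs_re_add_abs_im _).trans ?_
    rw [Complex.log_re]
    linarith
  have hl : |Real.log ‖u‖| = - Real.log ‖u‖ := abs_of_nonpos (Real.log_nonpos h3.le h2)
  have h4 : Real.log (‖u‖⁻¹) ≤ ‖u‖⁻¹ - 1 := Real.log_le_sub_one_of_pos (inv_pos.2 h3)
  rw [Real.log_inv] at h4
  have h5 : ‖u‖ * (- Real.log ‖u‖) ≤ ‖u‖ * (‖u‖⁻¹ - 1) := by gcongr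
  have h6 : ‖u‖ * (‖u‖⁻¹ - 1) = 1 - ‖u‖ := by field_simp
  have := Real.pi_pos
  calc ‖u‖ * ‖Complex.log u‖ ≤ ‖u‖ * (|Real.log ‖u‖| + Real.pi) := by gcongr
    _ ≤ 1 + Real.pi := by rw [hl]; nlinarith

lemma poly_aux (S : Finset ℂ) (hS : ∀ s ∈ S, s ∈ unitDisc) :
    ∃ (q : Polynomial ℂ) (K : ℝ), 0 ≤ K ∧ (∀ s ∈ S, q.eval s = 0) ∧
      ∀ ζ ∈ unitDisc, ‖q.eval ζ - 1‖ ≤ K * ‖(1 - ζ) / 2‖ := by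
  classical
  let p : Polynomial ℂ := ∏ s ∈ S, (Polynomial.X - Polynomial.C s)
  have hp1 : p.eval 1 ≠ 0 := by
    simp only [p, Polynomial.eval_prod]
    refine Finset.prod_ne_zero_iff.2 fun s hs => ?_
    have := mem_unitDisc.1 (hS s hs)
    simp only [Polynomial.eval_sub, Polynomial.eval_X, Polynomial.eval_C]
    intro h
    rw [← sub_eq_zero.1 h] at this
    simp at this
  let q : Polynomial ℂ := Polynomial.C (p.eval 1)⁻¹ * p
  have hq1 : q.eval 1 = 1 := by simp [q, hp1]
  have hd : (Polynomial.X - Polynomial.C 1) ∣ (q - 1) := by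
    rw [Polynomial.dvd_iff_isRoot]
    simp [hq1]
  obtain ⟨g, hg⟩ := hd
  obtain ⟨M, hM⟩ := (isCompact_closedBall (0 : ℂ) 1).exists_bound_of_continuousOn
    (f := fun x => g.eval x) g.continuous.continuousOn
  refine ⟨q, 2 * M, ?_, ?_, ?_⟩
  · have := (norm_nonneg _).trans (hM 0 (by simp))
    linarith
  · intro s hs
    simp only [q, p, Polynomial.eval_mul, Polynomial.eval_prod]
    have h0 : ∏ j ∈ S, (Polynomial.X - Polynomial.C j).eval s = 0 :=
      Finset.prod_eq_zero hs (by simp)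
    rw [h0, mul_zero]
  · intro ζ hζ
    have h1 : q.eval ζ - 1 = (ζ - 1) * g.eval ζ := by
      have := congrArg (Polynomial.eval ζ) hg
      simpa using this
    have h2 := hM ζ (by rw [mem_unitDisc] at hζ; simpa using hζ.le)
    rw [h1, norm_mul, norm_div, norm_sub_rev]
    simp only [Complex.norm_ofNat]
    have := norm_nonneg (1 - ζ)
    nlinarith

lemma peak (S : Finset ℂ) (hS : ∀ s ∈ S, s ∈ unitDisc) (δ : ℝ) (hδ : 0 < δ) :
    ∃ w : ℂ → ℂ, DifferentiableOn ℂ w unitDisc ∧ (∀ s ∈ S, w s = 1) ∧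
      (∀ ζ ∈ unitDisc, ‖w ζ‖ + ‖1 - w ζ‖ ≤ 1 + δ) ∧
      ∀ τ > 0, ∃ ζ ∈ unitDisc, ‖w ζ‖ < τ := by
  obtain ⟨q, K, hK, hq, hqK⟩ := poly_aux S hS
  have hpi := Real.pi_pos
  set C : ℝ := K * (1 + Real.pi) + Real.pi with hC
  have hCpos : 0 < C := by positivity
  obtain ⟨c, hc0, hc⟩ : ∃ c : ℝ, 0 < c ∧ 2 * Real.exp c - 1 + Real.exp c * c ≤ 1 + δ := by
    have ht : Tendsto (fun c : ℝ => 2 * Real.exp c - 1 + Real.exp c * c) (𝓝[>] 0) (𝓝 1) := by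
      have : ContinuousAt (fun c : ℝ => 2 * Real.exp c - 1 + Real.exp c * c) 0 := by fun_prop
      have h := this.tendsto.mono_left (nhdsWithin_le_nhds (s := Set.Ioi 0))
      norm_num at h
      exact h
    have h1 := ht.eventually (ge_mem_nhds (show (1 : ℝ) < 1 + δ by linarith))
    obtain ⟨c, h2, h3⟩ := (h1.and self_mem_nhdsWithin).exists
    exact ⟨c, h3, h2⟩
  set d : ℝ := c / C with hd
  have hdpos : 0 < d := by positivity
  have hdC : d * C = c := by rw [hd]; field_simp
  set X : ℂ → ℂ := fun ζ => q.eval ζ * Complex.log ((1 - ζ) / 2) with hX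
  have hbd : ∀ ζ ∈ unitDisc, ‖X ζ - Complex.log ((1 - ζ) / 2)‖ ≤ K * (1 + Real.pi) := by
    intro ζ hζ
    obtain ⟨h1, h2, h3⟩ := half_facts hζ
    have h4 := (log_aux h2 h3).1
    have : X ζ - Complex.log ((1 - ζ) / 2) = (q.eval ζ - 1) * Complex.log ((1 - ζ) / 2) := by
      simp only [hX]; ring
    rw [this, norm_mul]
    calc _ ≤ (K * ‖(1 - ζ) / 2‖) * ‖Complex.log ((1 - ζ) / 2)‖ := by
          gcongr; exact hqK ζ hζ
      _ = K * (‖(1 - ζ) / 2‖ * ‖Complex.log ((1 - ζ) / 2)‖) := by ring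
      _ ≤ _ := by gcongr
  have hre : ∀ ζ ∈ unitDisc, (X ζ).re ≤ Real.log ‖(1 - ζ) / 2‖ + C := by
    intro ζ hζ
    have h := (Complex.re_le_norm _).trans (hbd ζ hζ)
    rw [Complex.sub_re, Complex.log_re] at h
    linarith
  have him : ∀ ζ ∈ unitDisc, |(X ζ).im| ≤ C := by
    intro ζ hζ
    obtain ⟨h1, h2, h3⟩ := half_facts hζ
    have h4 := (log_aux h2 h3).2
    have h := (Complex.abs_im_le_norm _).trans (hbd ζ hζ)
    rw [Complex.sub_im] at h
    have := abs_add_le ((X ζ).im - (Complex.log ((1 - ζ) / 2)).im) (Complex.log ((1 - ζ) / 2)).im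
    rw [sub_add_cancel] at this
    linarith
  refine ⟨fun ζ => cexp ((d : ℂ) * X ζ), ?_, ?_, ?_, ?_⟩
  · intro ζ hζ
    have h1 := (half_facts hζ).1
    have : DifferentiableAt ℂ (fun ζ : ℂ => Complex.log ((1 - ζ) / 2)) ζ :=
      DifferentiableAt.clog (by fun_prop) (Or.inl h1)
    have hq' : DifferentiableAt ℂ (fun ζ : ℂ => q.eval ζ) ζ := q.differentiable ζ
    exact (((hq'.mul this).const_mul (d : ℂ)).cexp).differentiableWithinAt
  · intro s hs
    simp [hX, hq s hs]
  · intro ζ hζ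
    refine (exp_aux c hc0.le _ ?_ ?_).trans hc
    · rw [Complex.re_ofReal_mul, ← hdC]
      obtain ⟨h1, h2, h3⟩ := half_facts hζ
      have := Real.log_nonpos h3.le h2
      have := hre ζ hζ
      exact mul_le_mul_of_nonneg_left (by linarith) hdpos.le
    · rw [Complex.im_ofReal_mul, ← hdC, abs_mul, abs_of_pos hdpos]
      exact mul_le_mul_of_nonneg_left (him ζ hζ) hdpos.le
  · intro τ hτ
    have hlim : Tendsto (fun t : ℝ => Real.exp (d * (Real.log t + C))) (𝓝[>] 0) (𝓝 0) := by
      refine Real.tendsto_exp_atBot.comp ?_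
      exact (tendsto_atBot_add_const_right _ C Real.tendsto_log_nhdsGT_zero).const_mul_atBot hdpos
    have h1 := hlim.eventually (gt_mem_nhds hτ)
    have h2 : ∀ᶠ t : ℝ in 𝓝[>] 0, t < 1 :=
      nhdsWithin_le_nhds (gt_mem_nhds one_pos)
    obtain ⟨t, ⟨ht1, ht2⟩, ht0⟩ := ((h1.and h2).and self_mem_nhdsWithin).exists
    have ht0' : 0 < t := ht0
    have hmem : ((1 - 2 * t : ℝ) : ℂ) ∈ unitDisc := by
      rw [mem_unitDisc, Complex.norm_real, Real.norm_eq_abs, abs_lt]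
      constructor <;> linarith
    refine ⟨((1 - 2 * t : ℝ) : ℂ), hmem, ?_⟩
    rw [Complex.norm_exp, Complex.re_ofReal_mul]
    refine lt_of_le_of_lt (Real.exp_le_exp.2 (mul_le_mul_of_nonneg_left (hre _ hmem) hdpos.le)) ?_
    have : (1 - ((1 - 2 * t : ℝ) : ℂ)) / 2 = (t : ℂ) := by push_cast; ring
    rw [this, Complex.norm_real, Real.norm_eq_abs, abs_of_pos ht0']
    exact ht1

lemma add_aux {w f : ℂ → ℂ} (hw : DifferentiableOn ℂ w unitDisc)
    (hf : DifferentiableOn ℂ f unitDisc) {m m' δ : ℝ} (hm' : m' < 1) (hmm : m < m') (hm0 : 0 ≤ m)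
    (hδ : m' * (1 + δ) < 1)
    (hbd : ∀ ζ ∈ unitDisc, ‖w ζ‖ + ‖1 - w ζ‖ ≤ 1 + δ)
    (hfm : ∀ ζ ∈ unitDisc, ‖f ζ‖ ≤ m) {v : ℂ} (hv : ‖v‖ ≤ m) {ζ₀ : ℂ} (hζ₀ : ζ₀ ∈ unitDisc)
    (hτ : ‖w ζ₀‖ < (m' - m) / 2) :
    ∃ g, StrictDisc g ∧ g ζ₀ = v ∧ ∀ s, w s = 1 → g s = f s := by
  have hne : 1 - w ζ₀ ≠ 0 := by
    intro h
    rw [← sub_eq_zero.1 h] at hτ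
    simp at hτ
    linarith
  set v₀ := (v - w ζ₀ * f ζ₀) / (1 - w ζ₀) with hv₀
  have hv₀n : ‖v₀‖ ≤ m' := by
    rw [hv₀, norm_div, div_le_iff₀ (norm_pos_iff.2 hne)]
    have h1 : ‖v - w ζ₀ * f ζ₀‖ ≤ m + ‖w ζ₀‖ := by
      refine (norm_sub_le _ _).trans ?_
      rw [norm_mul]
      have := hfm ζ₀ hζ₀
      have := norm_nonneg (w ζ₀)
      nlinarith
    have h2 : 1 - ‖w ζ₀‖ ≤ ‖1 - w ζ₀‖ := by
      simpa using norm_sub_norm_le 1 (w ζ₀)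
    have := norm_nonneg (w ζ₀)
    nlinarith
  refine ⟨fun ζ => w ζ * f ζ + (1 - w ζ) * v₀, ⟨?_, m' * (1 + δ), hδ, ?_⟩, ?_, ?_⟩
  · exact (hw.mul hf).add (((differentiableOn_const 1).sub hw).mul_const v₀)
  · intro ζ hζ
    refine (norm_add_le _ _).trans ?_
    rw [norm_mul, norm_mul]
    have := hfm ζ hζ
    have h3 := hbd ζ hζ
    calc _ ≤ ‖w ζ‖ * m' + ‖1 - w ζ‖ * m' := by gcongr; linarith
      _ = m' * (‖w ζ‖ + ‖1 - w ζ‖) := by ring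
      _ ≤ _ := by gcongr; linarith
  · simp only [hv₀]
    field_simp
    ring
  · intro s hs
    simp [hs]

/-- Adding one interpolation point near the boundary. -/
lemma add_point {f₁ f₂ : ℂ → ℂ} (h₁ : StrictDisc f₁) (h₂ : StrictDisc f₂) (S : Finset ℂ)
    (hS : ∀ s ∈ S, s ∈ unitDisc) {v₁ v₂ : ℂ} (hv₁ : v₁ ∈ unitDisc) (hv₂ : v₂ ∈ unitDisc) :
    ∃ g₁ g₂ ζ, StrictDisc g₁ ∧ StrictDisc g₂ ∧ ζ ∈ unitDisc ∧ g₁ ζ = v₁ ∧ g₂ ζ = v₂ ∧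
      ∀ s ∈ S, g₁ s = f₁ s ∧ g₂ s = f₂ s := by
  obtain ⟨d₁, ρ₁, hρ₁, hb₁⟩ := h₁
  obtain ⟨d₂, ρ₂, hρ₂, hb₂⟩ := h₂
  rw [mem_unitDisc] at hv₁ hv₂
  set m := max (max ρ₁ ρ₂) (max ‖v₁‖ ‖v₂‖) with hm
  have hm1 : m < 1 := by simp [*]
  have hm0 : 0 ≤ m := (norm_nonneg v₁).trans ((le_max_left _ _).trans (le_max_right _ _))
  have e1 : ρ₁ ≤ m := (le_max_left _ _).trans (le_max_left _ _)
  have e2 : ρ₂ ≤ m := (le_max_right _ _).trans (le_max_left _ _)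
  have e3 : ‖v₁‖ ≤ m := (le_max_left _ _).trans (le_max_right _ _)
  have e4 : ‖v₂‖ ≤ m := (le_max_right _ _).trans (le_max_right _ _)
  set m' := (1 + m) / 2 with hm'
  have h1 : m' < 1 := by rw [hm']; linarith
  have h2 : m < m' := by rw [hm']; linarith
  set δ := (1 - m') / 2 with hδ
  have hδ0 : 0 < δ := by rw [hδ]; linarith
  have hδ1 : m' * (1 + δ) < 1 := by rw [hδ]; nlinarith
  obtain ⟨w, hw, hwS, hbd, hτ⟩ := peak S hS δ hδ0
  obtain ⟨ζ, hζ, hζτ⟩ := hτ ((m' - m) / 2) (by linarith)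
  obtain ⟨g₁, a1, a2, a3⟩ := add_aux hw d₁ h1 h2 hm0 hδ1 hbd
    (fun x hx => (hb₁ x hx).trans e1) e3 hζ hζτ
  obtain ⟨g₂, b1, b2, b3⟩ := add_aux hw d₂ h1 h2 hm0 hδ1 hbd
    (fun x hx => (hb₂ x hx).trans e2) e4 hζ hζτ
  exact ⟨g₁, g₂, ζ, a1, b1, hζ, a2, b2, fun s hs => ⟨a3 s (hwS s hs), b3 s (hwS s hs)⟩⟩

lemma coef_aux {f : ℂ → ℂ} {ζ₁ ζ₂ c₁ c₂ : ℂ} (hf : DifferentiableAt ℂ f ζ₁)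
    (h0 : ζ₁ ≠ 0) (h12 : ζ₁ ≠ ζ₂) (hc : c₁ ≠ 0) :
    Tendsto (fun ε : ℂ => (f ζ₁ + deriv f ζ₁ * c₁ * ε - f (ζ₁ + c₁ * ε)) /
      ((ζ₁ + c₁ * ε) * (c₁ * ε) * (ζ₁ + c₁ * ε - ζ₂) * (ζ₁ + c₁ * ε - (ζ₂ + c₂ * ε))))
      (𝓝[≠] 0) (𝓝 0) := by
  have hg : HasDerivAt (fun ε : ℂ => f (ζ₁ + c₁ * ε)) (deriv f ζ₁ * c₁) 0 := by
    have h1 : HasDerivAt (fun ε : ℂ => ζ₁ + c₁ * ε) c₁ 0 := by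
      simpa using ((hasDerivAt_id (0 : ℂ)).const_mul c₁).const_add ζ₁
    have h2 : HasDerivAt f (deriv f ζ₁) (ζ₁ + c₁ * 0) := by simpa using hf.hasDerivAt
    exact h2.comp (0 : ℂ) h1
  have h1 := (hasDerivAt_iff_tendsto_slope_zero.1 hg).const_sub (deriv f ζ₁ * c₁)
  have h2 : Tendsto (fun ε : ℂ => (c₁ * ((ζ₁ + c₁ * ε) * (ζ₁ + c₁ * ε - ζ₂)
      * (ζ₁ + c₁ * ε - (ζ₂ + c₂ * ε))))⁻¹) (𝓝[≠] 0)
      (𝓝 (c₁ * ((ζ₁ + c₁ * 0) * (ζ₁ + c₁ * 0 - ζ₂) * (ζ₁ + c₁ * 0 - (ζ₂ + c₂ * 0))))⁻¹) := by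
    refine Tendsto.inv₀ ?_ ?_
    · refine Tendsto.mono_left (Continuous.tendsto ?_ 0) nhdsWithin_le_nhds
      fun_prop
    · simp [h0, hc, sub_ne_zero.2 h12]
  have h3 := h1.mul h2
  rw [sub_self, zero_mul] at h3
  refine h3.congr' ?_
  filter_upwards [self_mem_nhdsWithin] with ε hε
  have hε : ε ≠ 0 := hε
  simp only [zero_add, mul_zero, add_zero, smul_eq_mul]
  rw [div_eq_mul_inv,
    show (ζ₁ + c₁ * ε) * (c₁ * ε) * (ζ₁ + c₁ * ε - ζ₂) * (ζ₁ + c₁ * ε - (ζ₂ + c₂ * ε))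
      = ε * (c₁ * ((ζ₁ + c₁ * ε) * (ζ₁ + c₁ * ε - ζ₂) * (ζ₁ + c₁ * ε - (ζ₂ + c₂ * ε)))) by ring,
    mul_inv ε]
  generalize (c₁ * ((ζ₁ + c₁ * ε) * (ζ₁ + c₁ * ε - ζ₂) * (ζ₁ + c₁ * ε - (ζ₂ + c₂ * ε))))⁻¹ = D
  field_simp
  ring

lemma norm_sub_le_two {x y : ℂ} (hx : x ∈ unitDisc) (hy : y ∈ unitDisc) : ‖x - y‖ ≤ 2 := by
  rw [mem_unitDisc] at hx hy
  linarith [norm_sub_le x y]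

lemma unitDisc_isOpen : IsOpen unitDisc := isOpen_ball

lemma tendsto_aff (p c : ℂ) : Tendsto (fun ε : ℂ => p + c * ε) (𝓝[≠] 0) (𝓝 p) := by
  have h : Continuous (fun ε : ℂ => p + c * ε) := by fun_prop
  have h2 := (h.tendsto 0).mono_left (nhdsWithin_le_nhds (s := {0}ᶜ))
  simpa using h2

lemma perturb {f : ℂ → ℂ} (hf : StrictDisc f) {ζ₁ ζ₂ c₁ c₂ : ℂ} (hζ₁ : ζ₁ ∈ unitDisc)
    (hζ₂ : ζ₂ ∈ unitDisc) (h1 : ζ₁ ≠ 0) (h2 : ζ₂ ≠ 0) (h12 : ζ₁ ≠ ζ₂) (hc₁ : c₁ ≠ 0)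
    (hc₂ : c₂ ≠ 0) :
    ∀ᶠ ε in 𝓝[≠] (0 : ℂ), ∃ g, StrictDisc g ∧ g 0 = f 0 ∧ g ζ₁ = f ζ₁ ∧ g ζ₂ = f ζ₂ ∧
      g (ζ₁ + c₁ * ε) = f ζ₁ + deriv f ζ₁ * c₁ * ε ∧
      g (ζ₂ + c₂ * ε) = f ζ₂ + deriv f ζ₂ * c₂ * ε := by
  obtain ⟨hd, ρ, hρ, hb⟩ := hf
  have hA := coef_aux (c₂ := c₂) (hd.differentiableAt (unitDisc_isOpen.mem_nhds hζ₁)) h1 h12 hc₁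
  have hB := coef_aux (c₂ := c₁) (hd.differentiableAt (unitDisc_isOpen.mem_nhds hζ₂)) h2 h12.symm
    hc₂
  have hs := (hA.norm.add hB.norm).eventually (gt_mem_nhds (show ‖(0 : ℂ)‖ + ‖(0 : ℂ)‖ <
    (1 - ρ) / 16 by simp; linarith))
  have t1 := tendsto_aff ζ₁ c₁
  have t2 := tendsto_aff ζ₂ c₂
  have tt := (t1.sub t2).eventually_ne (sub_ne_zero.2 h12)
  filter_upwards [hs, t1.eventually (unitDisc_isOpen.mem_nhds hζ₁),
    t2.eventually (unitDisc_isOpen.mem_nhds hζ₂), t1.eventually_ne h1, t2.eventually_ne h2,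
    t1.eventually_ne h12, t2.eventually_ne h12.symm, tt, self_mem_nhdsWithin]
    with ε hs m1 m2 n1 n2 n3 n4 n5 hε
  have hε : ε ≠ 0 := hε
  set A := (f ζ₁ + deriv f ζ₁ * c₁ * ε - f (ζ₁ + c₁ * ε)) /
      ((ζ₁ + c₁ * ε) * (c₁ * ε) * (ζ₁ + c₁ * ε - ζ₂) * (ζ₁ + c₁ * ε - (ζ₂ + c₂ * ε))) with hA'
  set B := (f ζ₂ + deriv f ζ₂ * c₂ * ε - f (ζ₂ + c₂ * ε)) /
      ((ζ₂ + c₂ * ε) * (c₂ * ε) * (ζ₂ + c₂ * ε - ζ₁) * (ζ₂ + c₂ * ε - (ζ₁ + c₁ * ε))) with hB'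
  set p := ζ₁ + c₁ * ε with hp
  set q := ζ₂ + c₂ * ε with hq
  have D1 : p * (c₁ * ε) * (p - ζ₂) * (p - q) ≠ 0 := by
    simp [n1, hc₁, hε, sub_ne_zero.2 n3, n5]
  have D2 : q * (c₂ * ε) * (q - ζ₁) * (q - p) ≠ 0 := by
    have : q - p ≠ 0 := by rw [← neg_sub]; exact neg_ne_zero.2 n5
    simp [n2, hc₂, hε, sub_ne_zero.2 n4, this]
  refine ⟨fun x => f x + (A * (x * (x - ζ₁) * (x - ζ₂) * (x - q))
    + B * (x * (x - ζ₂) * (x - ζ₁) * (x - p))),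
    ⟨hd.add (by fun_prop), ρ + 16 * (‖A‖ + ‖B‖), by linarith, ?_⟩, by simp, by simp, by simp,
      ?_, ?_⟩
  · intro x hx
    have b1 := norm_sub_le_two hx hζ₁
    have b2 := norm_sub_le_two hx hζ₂
    have b3 := norm_sub_le_two hx m1
    have b4 := norm_sub_le_two hx m2
    have b0 : ‖x‖ ≤ 2 := by rw [mem_unitDisc] at hx; linarith
    refine (norm_add_le _ _).trans (add_le_add (hb x hx) ((norm_add_le _ _).trans ?_))
    simp only [norm_mul]
    have k1 : ‖x‖ * ‖x - ζ₁‖ * ‖x - ζ₂‖ * ‖x - q‖ ≤ 2 * 2 * 2 * 2 := by gcongr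
    have k2 : ‖x‖ * ‖x - ζ₂‖ * ‖x - ζ₁‖ * ‖x - p‖ ≤ 2 * 2 * 2 * 2 := by gcongr
    have := norm_nonneg A
    have := norm_nonneg B
    nlinarith
  · have : p * (p - ζ₁) * (p - ζ₂) * (p - q) = p * (c₁ * ε) * (p - ζ₂) * (p - q) := by
      rw [hp]; ring
    simp only [sub_self, mul_zero, add_zero]
    rw [this, hA', div_mul_cancel₀ _ D1]
    ring
  · have : q * (q - ζ₂) * (q - ζ₁) * (q - p) = q * (c₂ * ε) * (q - ζ₁) * (q - p) := by
      rw [hq]; ring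
    simp only [sub_self, mul_zero, zero_add]
    rw [this, hB', div_mul_cancel₀ _ D2]
    ring

lemma make_deriv {f : ℂ → ℂ} (hf : StrictDisc f) {ζ₁ ζ₂ : ℂ} (hζ₁ : ζ₁ ∈ unitDisc)
    (hζ₂ : ζ₂ ∈ unitDisc) (h1 : ζ₁ ≠ 0) (h2 : ζ₂ ≠ 0) (h12 : ζ₁ ≠ ζ₂) :
    ∃ g, StrictDisc g ∧ g 0 = f 0 ∧ g ζ₁ = f ζ₁ ∧ g ζ₂ = f ζ₂ ∧ deriv g ζ₁ ≠ 0 ∧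
      deriv g ζ₂ ≠ 0 := by
  obtain ⟨hd, ρ, hρ, hb⟩ := hf
  have key : ∀ u v : ℂ, v ≠ 0 → ∀ᶠ η in 𝓝[≠] (0 : ℂ), u + η * v ≠ 0 := by
    intro u v hv
    by_cases hu : u = 0
    · filter_upwards [self_mem_nhdsWithin] with η hη
      have hη : η ≠ 0 := hη
      simp [hu, hη, hv]
    · have := (tendsto_aff u v).eventually_ne hu
      simpa [mul_comm] using this
  have hsm : ∀ᶠ η in 𝓝[≠] (0 : ℂ), ‖η‖ < (1 - ρ) / 8 := by
    refine nhdsWithin_le_nhds ?_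
    have : Tendsto (fun η : ℂ => ‖η‖) (𝓝 0) (𝓝 0) := by simpa using (continuous_norm.tendsto (0 : ℂ))
    exact this.eventually (gt_mem_nhds (by linarith))
  obtain ⟨η, ⟨e1, e2⟩, e3⟩ := (((key (deriv f ζ₁) (ζ₁ * (ζ₁ - ζ₂))
    (mul_ne_zero h1 (sub_ne_zero.2 h12))).and (key (deriv f ζ₂) (ζ₂ * (ζ₂ - ζ₁))
    (mul_ne_zero h2 (sub_ne_zero.2 h12.symm)))).and hsm).exists
  have hder : ∀ x, HasDerivAt (fun x : ℂ => η * (x * (x - ζ₁) * (x - ζ₂)))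
      (η * ((1 * (x - ζ₁) + x * 1) * (x - ζ₂) + x * (x - ζ₁) * 1)) x := by
    intro x
    exact ((((hasDerivAt_id x).mul ((hasDerivAt_id x).sub_const ζ₁)).mul
      ((hasDerivAt_id x).sub_const ζ₂)).const_mul η)
  have hder2 : ∀ x ∈ unitDisc, deriv (fun x => f x + η * (x * (x - ζ₁) * (x - ζ₂))) x
      = deriv f x + (η * ((1 * (x - ζ₁) + x * 1) * (x - ζ₂) + x * (x - ζ₁) * 1)) := by
    intro x hx
    exact ((hd.differentiableAt (unitDisc_isOpen.mem_nhds hx)).hasDerivAt.add (hder x)).deriv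
  refine ⟨fun x => f x + η * (x * (x - ζ₁) * (x - ζ₂)),
    ⟨hd.add (by fun_prop), ρ + 8 * ‖η‖, by linarith, ?_⟩, by simp, by simp, by simp, ?_, ?_⟩
  · intro x hx
    have b1 := norm_sub_le_two hx hζ₁
    have b2 := norm_sub_le_two hx hζ₂
    have b0 : ‖x‖ ≤ 2 := by rw [mem_unitDisc] at hx; linarith
    refine (norm_add_le _ _).trans (add_le_add (hb x hx) ?_)
    simp only [norm_mul]
    have k1 : ‖x‖ * ‖x - ζ₁‖ * ‖x - ζ₂‖ ≤ 2 * 2 * 2 := by gcongr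
    have := norm_nonneg η
    nlinarith
  · rw [hder2 ζ₁ hζ₁]
    convert e1 using 1
    ring
  · rw [hder2 ζ₂ hζ₂]
    convert e2 using 1
    ring

lemma pert2 {f₁ f₂ : ℂ → ℂ} (hf₁ : StrictDisc f₁) (hf₂ : StrictDisc f₂) {ζ₁ ζ₂ : ℂ}
    (hζ₁ : ζ₁ ∈ unitDisc) (hζ₂ : ζ₂ ∈ unitDisc) (h1 : ζ₁ ≠ 0) (h2 : ζ₂ ≠ 0) (h12 : ζ₁ ≠ ζ₂)
    (e1 : f₂ ζ₁ = 0) (e2 : f₂ ζ₂ = 0) :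
    ∃ c₁ c₂ : ℂ, ∀ᶠ ε in 𝓝[≠] (0 : ℂ), ∃ g₁ g₂, StrictDisc g₁ ∧ StrictDisc g₂ ∧
      g₁ 0 = f₁ 0 ∧ g₂ 0 = f₂ 0 ∧ g₁ ζ₁ = f₁ ζ₁ ∧ g₂ ζ₁ = 0 ∧ g₁ ζ₂ = f₁ ζ₂ ∧ g₂ ζ₂ = 0 ∧
      g₁ (ζ₁ + c₁ * ε) = f₁ ζ₁ + deriv f₁ ζ₁ * c₁ * ε ∧
      g₁ (ζ₂ + c₂ * ε) = f₁ ζ₂ + deriv f₁ ζ₂ * c₂ * ε ∧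
      g₂ (ζ₁ + c₁ * ε) = ε ∧ g₂ (ζ₂ + c₂ * ε) = ε := by
  obtain ⟨f, hf, k0, k1, k2, d1, d2⟩ := make_deriv hf₂ hζ₁ hζ₂ h1 h2 h12
  refine ⟨(deriv f ζ₁)⁻¹, (deriv f ζ₂)⁻¹, ?_⟩
  filter_upwards [perturb hf₁ hζ₁ hζ₂ h1 h2 h12 (inv_ne_zero d1) (inv_ne_zero d2),
    perturb hf hζ₁ hζ₂ h1 h2 h12 (inv_ne_zero d1) (inv_ne_zero d2)] with ε hA hB
  obtain ⟨g₁, a0, a1, a2, a3, a4, a5⟩ := hA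
  obtain ⟨g₂, b0, b1, b2, b3, b4, b5⟩ := hB
  refine ⟨g₁, g₂, a0, b0, a1, b1.trans k0, a2, ?_, a3, ?_, a4, a5, ?_, ?_⟩
  · rw [b2, k1, e1]
  · rw [b3, k2, e2]
  · rw [b4, k1, e1, mul_inv_cancel₀ d1]; ring
  · rw [b5, k2, e2, mul_inv_cancel₀ d2]; ring

lemma elog_coe {x : ℂ} (h : x ≠ 0) : elog ‖x‖ = ((Real.log ‖x‖ : ℝ) : EReal) := by
  simp [elog, h]

lemma elog_nonpos {x : ℂ} (h : x ∈ unitDisc) : elog ‖x‖ ≤ 0 := by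
  by_cases hx : x = 0
  · simp [elog, hx]
  · rw [elog_coe hx]
    exact_mod_cast Real.log_nonpos (norm_nonneg _) (mem_unitDisc.1 h).le

lemma Leps4_le {a b ε : ℂ} {z : ℂ × ℂ} {φ₁ φ₂ : ℂ → ℂ} {ζ₁ ζ₂ ζ₃ ζ₄ : ℂ}
    (h₁ : StrictDisc φ₁) (h₂ : StrictDisc φ₂)
    (m1 : ζ₁ ∈ unitDisc) (m2 : ζ₂ ∈ unitDisc) (m3 : ζ₃ ∈ unitDisc) (m4 : ζ₄ ∈ unitDisc)
    (z1 : φ₁ 0 = z.1) (z2 : φ₂ 0 = z.2)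
    (e1 : φ₁ ζ₁ = a) (e2 : φ₂ ζ₁ = 0) (e3 : φ₁ ζ₂ = b) (e4 : φ₂ ζ₂ = 0)
    (e5 : φ₁ ζ₃ = b) (e6 : φ₂ ζ₃ = ε) (e7 : φ₁ ζ₄ = a) (e8 : φ₂ ζ₄ = ε) :
    Leps4 a b ε z ≤ elog ‖ζ₁‖ + elog ‖ζ₂‖ + elog ‖ζ₃‖ + elog ‖ζ₄‖ :=
  sInf_le ⟨φ₁, φ₂, ζ₁, ζ₂, ζ₃, ζ₄, ⟨h₁.1, h₂.1, h₁.maps, h₂.maps⟩, m1, m2, m3, m4, z1, z2,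
    e1, e2, e3, e4, e5, e6, e7, e8, rfl⟩

lemma Leps4_swap_le (a b ε : ℂ) (z : ℂ × ℂ) : Leps4 a b ε z ≤ Leps4 b a ε z := by
  refine le_sInf ?_
  rintro t ⟨φ₁, φ₂, ζ₁, ζ₂, ζ₃, ζ₄, hd, m1, m2, m3, m4, z1, z2, e1, e2, e3, e4, e5, e6, e7, e8, rfl⟩
  refine sInf_le ⟨φ₁, φ₂, ζ₂, ζ₁, ζ₄, ζ₃, hd, m2, m1, m4, m3, z1, z2, e3, e4, e1, e2, e7, e8, e5,
    e6, ?_⟩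
  rw [add_comm (elog ‖ζ₁‖), add_right_comm]

lemma Leps4_swap (a b : ℂ) (z : ℂ × ℂ) :
    (fun ε => Leps4 a b ε z) = (fun ε => Leps4 b a ε z) :=
  funext fun ε => le_antisymm (Leps4_swap_le a b ε z) (Leps4_swap_le b a ε z)

lemma zero_mem_unitDisc : (0 : ℂ) ∈ unitDisc := by simp [mem_unitDisc]

lemma StrictDisc.const {c : ℂ} (hc : c ∈ unitDisc) : StrictDisc (fun _ => c) :=
  ⟨differentiableOn_const c, ‖c‖, mem_unitDisc.1 hc, fun _ _ => le_rfl⟩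

/-- Disc through three poles can be completed. -/
lemma complete3 {a b ε : ℂ} (hb : b ∈ unitDisc) (hε : ε ∈ unitDisc) {z : ℂ × ℂ}
    {φ₁ φ₂ : ℂ → ℂ} {ζ₁ ζ₂ ζ₄ : ℂ} (h₁ : StrictDisc φ₁) (h₂ : StrictDisc φ₂)
    (m1 : ζ₁ ∈ unitDisc) (m2 : ζ₂ ∈ unitDisc) (m4 : ζ₄ ∈ unitDisc)
    (z1 : φ₁ 0 = z.1) (z2 : φ₂ 0 = z.2)
    (e1 : φ₁ ζ₁ = a) (e2 : φ₂ ζ₁ = 0) (e3 : φ₁ ζ₂ = b) (e4 : φ₂ ζ₂ = 0)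
    (e7 : φ₁ ζ₄ = a) (e8 : φ₂ ζ₄ = ε) :
    Leps4 a b ε z ≤ elog ‖ζ₁‖ + elog ‖ζ₂‖ + elog ‖ζ₄‖ := by
  classical
  obtain ⟨g₁, g₂, ζ₃, s1, s2, m3, k1, k2, hg⟩ := add_point h₁ h₂ {0, ζ₁, ζ₂, ζ₄}
    (by simp [zero_mem_unitDisc, *]) hb hε
  simp only [Finset.mem_insert, Finset.mem_singleton, forall_eq_or_imp, forall_eq] at hg
  obtain ⟨⟨p1, p2⟩, ⟨p3, p4⟩, ⟨p5, p6⟩, p7, p8⟩ := hg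
  refine (Leps4_le s1 s2 m1 m2 m3 m4 (p1.trans z1) (p2.trans z2) (p3.trans e1) (p4.trans e2)
    (p5.trans e3) (p6.trans e4) k1 k2 (p7.trans e7) (p8.trans e8)).trans ?_
  refine add_le_add ?_ le_rfl
  calc elog ‖ζ₁‖ + elog ‖ζ₂‖ + elog ‖ζ₃‖ ≤ elog ‖ζ₁‖ + elog ‖ζ₂‖ + 0 := by
        gcongr; exact elog_nonpos m3
    _ = _ := add_zero _

/-- Disc through two poles can be completed. -/
lemma complete2 {a b ε : ℂ} (ha : a ∈ unitDisc) (hb : b ∈ unitDisc) (hε : ε ∈ unitDisc)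
    {z : ℂ × ℂ} {φ₁ φ₂ : ℂ → ℂ} {ζ₁ ζ₂ : ℂ} (h₁ : StrictDisc φ₁) (h₂ : StrictDisc φ₂)
    (m1 : ζ₁ ∈ unitDisc) (m2 : ζ₂ ∈ unitDisc) (z1 : φ₁ 0 = z.1) (z2 : φ₂ 0 = z.2)
    (e1 : φ₁ ζ₁ = a) (e2 : φ₂ ζ₁ = 0) (e3 : φ₁ ζ₂ = b) (e4 : φ₂ ζ₂ = 0) :
    Leps4 a b ε z ≤ elog ‖ζ₁‖ + elog ‖ζ₂‖ := by
  classical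
  obtain ⟨g₁, g₂, ζ₃, s1, s2, m3, k1, k2, hg⟩ := add_point h₁ h₂ {0, ζ₁, ζ₂}
    (by simp [zero_mem_unitDisc, *]) ha hε
  simp only [Finset.mem_insert, Finset.mem_singleton, forall_eq_or_imp, forall_eq] at hg
  obtain ⟨⟨p1, p2⟩, ⟨p3, p4⟩, p5, p6⟩ := hg
  refine (complete3 hb hε s1 s2 m1 m2 m3 (p1.trans z1) (p2.trans z2) (p3.trans e1) (p4.trans e2)
    (p5.trans e3) (p6.trans e4) k1 k2).trans ?_
  calc elog ‖ζ₁‖ + elog ‖ζ₂‖ + elog ‖ζ₃‖ ≤ elog ‖ζ₁‖ + elog ‖ζ₂‖ + 0 := by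
        gcongr; exact elog_nonpos m3
    _ = _ := add_zero _

lemma eventually_mem : ∀ᶠ ε in 𝓝[≠] (0 : ℂ), ε ∈ unitDisc :=
  nhdsWithin_le_nhds (unitDisc_isOpen.mem_nhds zero_mem_unitDisc)

lemma limsup_bot {a b : ℂ} (ha : a ∈ unitDisc) (hb : b ∈ unitDisc) {z : ℂ × ℂ}
    (z1 : z.1 = a) (z2 : z.2 = 0) :
    limsup (fun ε => Leps4 a b ε z) (𝓝[≠] (0 : ℂ)) ≤ ⊥ := by
  refine limsup_le_of_le (h := ?_)
  filter_upwards [eventually_mem] with ε hε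
  obtain ⟨g₁, g₂, ζ₂, s1, s2, m2, k1, k2, hg⟩ := add_point (StrictDisc.const ha)
    (StrictDisc.const zero_mem_unitDisc) {0} (by simp [zero_mem_unitDisc]) hb zero_mem_unitDisc
  simp only [Finset.mem_singleton, forall_eq] at hg
  refine (complete2 ha hb hε s1 s2 zero_mem_unitDisc m2 (hg.1.trans z1.symm) (hg.2.trans z2.symm)
    hg.1 hg.2 k1 k2).trans ?_
  simp [elog]

/-- If some node is the origin the limsup is `⊥`. -/
lemma limsup_bot' {a b : ℂ} (ha : a ∈ unitDisc) (hb : b ∈ unitDisc) {z : ℂ × ℂ}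
    {φ₁ φ₂ : ℂ → ℂ} {ζ₁ ζ₂ : ℂ} (z1 : φ₁ 0 = z.1) (z2 : φ₂ 0 = z.2)
    (e1 : φ₁ ζ₁ = a) (e2 : φ₂ ζ₁ = 0) (e3 : φ₁ ζ₂ = b) (e4 : φ₂ ζ₂ = 0)
    (h : ζ₁ = 0 ∨ ζ₂ = 0) (t : EReal) :
    limsup (fun ε => Leps4 a b ε z) (𝓝[≠] (0 : ℂ)) ≤ t := by
  rcases h with rfl | rfl
  · exact (limsup_bot ha hb (z1.symm.trans e1) (z2.symm.trans e2)).trans bot_le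
  · rw [Leps4_swap]
    exact (limsup_bot hb ha (z1.symm.trans e3) (z2.symm.trans e4)).trans bot_le

lemma shrink_limit {x y : ℝ} (hx0 : x ≠ 0) (hy0 : y ≠ 0) (hx : x < 1) (hy : y < 1) (m n : ℝ)
    (X : EReal)
    (h : ∀ r : ℝ, 0 < r → r < 1 → x < r → y < r →
      X ≤ ((m * Real.log (x / r) + n * Real.log (y / r) : ℝ) : EReal)) :
    X ≤ ((m * Real.log x + n * Real.log y : ℝ) : EReal) := by
  have hc : ∀ u : ℝ, u ≠ 0 → Tendsto (fun r : ℝ => Real.log (u / r)) (𝓝[<] 1) (𝓝 (Real.log u)) := by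
    intro u hu
    have h1 : ContinuousAt (fun r : ℝ => Real.log (u / r)) 1 :=
      (continuousAt_const.div continuousAt_id one_ne_zero).log (by simpa using hu)
    have h2 := h1.tendsto.mono_left (nhdsWithin_le_nhds (s := Set.Iio 1))
    simpa using h2
  have ht : Tendsto (fun r : ℝ => ((m * Real.log (x / r) + n * Real.log (y / r) : ℝ) : EReal))
      (𝓝[<] 1) (𝓝 ((m * Real.log x + n * Real.log y : ℝ) : EReal)) :=
    (continuous_coe_real_ereal.tendsto _).comp
      (((hc x hx0).const_mul m).add ((hc y hy0).const_mul n))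
  refine ge_of_tendsto ht ?_
  filter_upwards [self_mem_nhdsWithin, nhdsWithin_le_nhds (lt_mem_nhds hx),
    nhdsWithin_le_nhds (lt_mem_nhds hy), nhdsWithin_le_nhds (lt_mem_nhds one_pos)]
    with r h1 h2 h3 h4
  exact h r h4 h1 h2 h3

lemma tendsto_log_aff {p : ℂ} (hp : p ≠ 0) (c : ℂ) :
    Tendsto (fun ε : ℂ => Real.log ‖p + c * ε‖) (𝓝[≠] 0) (𝓝 (Real.log ‖p‖)) :=
  (tendsto_aff p c).norm.log (norm_ne_zero_iff.2 hp)

lemma coreV {a b : ℂ} (hb : b ∈ unitDisc) {z : ℂ × ℂ} {φ₁ φ₂ : ℂ → ℂ} {ζ₁ ζ₂ : ℂ}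
    (h₁ : StrictDisc φ₁) (h₂ : StrictDisc φ₂)
    (m1 : ζ₁ ∈ unitDisc) (m2 : ζ₂ ∈ unitDisc) (n1 : ζ₁ ≠ 0) (n2 : ζ₂ ≠ 0) (n12 : ζ₁ ≠ ζ₂)
    (z1 : φ₁ 0 = z.1) (z2 : φ₂ 0 = z.2)
    (e1 : φ₁ ζ₁ = a) (e2 : φ₂ ζ₁ = 0) (e3 : φ₁ ζ₂ = b) (e4 : φ₂ ζ₂ = 0)
    (d1 : deriv φ₁ ζ₁ = 0) :
    limsup (fun ε => Leps4 a b ε z) (𝓝[≠] (0 : ℂ)) ≤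
      ((2 * Real.log ‖ζ₁‖ + 1 * Real.log ‖ζ₂‖ : ℝ) : EReal) := by
  obtain ⟨c₁, c₂, hev⟩ := pert2 h₁ h₂ m1 m2 n1 n2 n12 e2 e4
  have ht : Tendsto (fun ε : ℂ =>
      ((Real.log ‖ζ₁‖ + Real.log ‖ζ₂‖ + Real.log ‖ζ₁ + c₁ * ε‖ : ℝ) : EReal)) (𝓝[≠] 0)
      (𝓝 ((2 * Real.log ‖ζ₁‖ + 1 * Real.log ‖ζ₂‖ : ℝ) : EReal)) := by
    have h := (continuous_coe_real_ereal.tendsto _).comp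
      ((tendsto_log_aff n1 c₁).const_add (Real.log ‖ζ₁‖ + Real.log ‖ζ₂‖))
    refine (h.congr fun x => rfl).trans (le_of_eq ?_)
    congr 2
    ring
  rw [← ht.limsup_eq]
  refine limsup_le_limsup ?_
  have t1 := tendsto_aff ζ₁ c₁
  filter_upwards [hev, eventually_mem, t1.eventually (unitDisc_isOpen.mem_nhds m1),
    t1.eventually_ne n1] with ε hg hε m4 n4
  obtain ⟨g₁, g₂, s1, s2, p1, p2, p3, p4, p5, p6, p7, p8, p9, p10⟩ := hg
  have hle := complete3 hb hε s1 s2 m1 m2 m4 (p1.trans z1) (p2.trans z2) (p3.trans e1) p4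
    (p5.trans e3) p6 (by rw [p7, d1, e1]; ring) p9
  rw [elog_coe n1, elog_coe n2, elog_coe n4] at hle
  exact_mod_cast hle

lemma coreVV {a b : ℂ} {z : ℂ × ℂ} {φ₁ φ₂ : ℂ → ℂ} {ζ₁ ζ₂ : ℂ}
    (h₁ : StrictDisc φ₁) (h₂ : StrictDisc φ₂)
    (m1 : ζ₁ ∈ unitDisc) (m2 : ζ₂ ∈ unitDisc) (n1 : ζ₁ ≠ 0) (n2 : ζ₂ ≠ 0) (n12 : ζ₁ ≠ ζ₂)
    (z1 : φ₁ 0 = z.1) (z2 : φ₂ 0 = z.2)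
    (e1 : φ₁ ζ₁ = a) (e2 : φ₂ ζ₁ = 0) (e3 : φ₁ ζ₂ = b) (e4 : φ₂ ζ₂ = 0)
    (d1 : deriv φ₁ ζ₁ = 0) (d2 : deriv φ₁ ζ₂ = 0) :
    limsup (fun ε => Leps4 a b ε z) (𝓝[≠] (0 : ℂ)) ≤
      ((2 * Real.log ‖ζ₁‖ + 2 * Real.log ‖ζ₂‖ : ℝ) : EReal) := by
  obtain ⟨c₁, c₂, hev⟩ := pert2 h₁ h₂ m1 m2 n1 n2 n12 e2 e4
  have ht : Tendsto (fun ε : ℂ => ((Real.log ‖ζ₁‖ + Real.log ‖ζ₂‖ + Real.log ‖ζ₂ + c₂ * ε‖ +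
      Real.log ‖ζ₁ + c₁ * ε‖ : ℝ) : EReal)) (𝓝[≠] 0)
      (𝓝 ((2 * Real.log ‖ζ₁‖ + 2 * Real.log ‖ζ₂‖ : ℝ) : EReal)) := by
    have h := (continuous_coe_real_ereal.tendsto _).comp
      (((tendsto_log_aff n2 c₂).const_add (Real.log ‖ζ₁‖ + Real.log ‖ζ₂‖)).add
        (tendsto_log_aff n1 c₁))
    refine (h.congr fun x => rfl).trans (le_of_eq ?_)
    congr 2
    ring
  rw [← ht.limsup_eq]
  refine limsup_le_limsup ?_
  have t1 := tendsto_aff ζ₁ c₁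
  have t2 := tendsto_aff ζ₂ c₂
  filter_upwards [hev, t1.eventually (unitDisc_isOpen.mem_nhds m1), t1.eventually_ne n1,
    t2.eventually (unitDisc_isOpen.mem_nhds m2), t2.eventually_ne n2] with ε hg m4 n4 m3 n3
  obtain ⟨g₁, g₂, s1, s2, p1, p2, p3, p4, p5, p6, p7, p8, p9, p10⟩ := hg
  have hle := Leps4_le s1 s2 m1 m2 m3 m4 (p1.trans z1) (p2.trans z2) (p3.trans e1) p4
    (p5.trans e3) p6 (by rw [p8, d2, e3]; ring) p10 (by rw [p7, d1, e1]; ring) p9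
  rw [elog_coe n1, elog_coe n2, elog_coe n3, elog_coe n4] at hle
  exact_mod_cast hle

lemma div_r_mem {x : ℂ} {r : ℝ} (hr : 0 < r) (h : ‖x‖ < r) : x / r ∈ unitDisc := by
  rw [mem_unitDisc, norm_div, Complex.norm_real, Real.norm_eq_abs, abs_of_pos hr]
  exact (div_lt_one hr).2 h

lemma norm_div_r {x : ℂ} {r : ℝ} (hr : 0 < r) : ‖x / r‖ = ‖x‖ / r := by
  rw [norm_div, Complex.norm_real, Real.norm_eq_abs, abs_of_pos hr]

lemma mul_div_r {x : ℂ} {r : ℝ} (hr : 0 < r) : (r : ℂ) * (x / r) = x := by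
  have : (r : ℂ) ≠ 0 := by exact_mod_cast hr.ne'
  field_simp

lemma deriv_r {f : ℂ → ℂ} {x : ℂ} {r : ℝ} (hr : 0 < r) (h : deriv f x = 0) :
    deriv (fun w => f (r * w)) (x / r) = 0 := by
  rw [deriv_comp_mul_left, mul_div_r hr, h, smul_zero]

lemma div_r_inj {x y : ℂ} {r : ℝ} (hr : 0 < r) (h : x ≠ y) : x / (r : ℂ) ≠ y / r := by
  intro h2
  apply h
  rw [← mul_div_r (x := x) hr, h2, mul_div_r hr]

lemma case0 {a b : ℂ} (ha : a ∈ unitDisc) (hb : b ∈ unitDisc) (z : ℂ × ℂ) :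
    limsup (fun ε => Leps4 a b ε z) (𝓝[≠] (0 : ℂ)) ≤ La0b0 a b z := by
  refine le_sInf ?_
  rintro t ⟨φ₁, φ₂, ζ₁, ζ₂, hd, m1, m2, z1, z2, e1, e2, e3, e4, rfl⟩
  by_cases h0 : ζ₁ = 0 ∨ ζ₂ = 0
  · exact limsup_bot' ha hb z1 z2 e1 e2 e3 e4 h0 _
  push Not at h0
  obtain ⟨n1, n2⟩ := h0
  rw [elog_coe n1, elog_coe n2, ← EReal.coe_add]
  have key := shrink_limit (norm_ne_zero_iff.2 n1) (norm_ne_zero_iff.2 n2) (mem_unitDisc.1 m1)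
    (mem_unitDisc.1 m2) 1 1 (limsup (fun ε => Leps4 a b ε z) (𝓝[≠] (0 : ℂ))) ?_
  · simpa only [one_mul] using key
  intro r r0 r1 hx hy
  have r0' : (r : ℂ) ≠ 0 := by exact_mod_cast r0.ne'
  refine limsup_le_of_le (h := ?_)
  filter_upwards [eventually_mem] with ε hε
  have := complete2 (z := z) ha hb hε (StrictDisc.shrink hd.1 hd.2.2.1 r0 r1)
    (StrictDisc.shrink hd.2.1 hd.2.2.2 r0 r1) (div_r_mem r0 hx) (div_r_mem r0 hy)
    (by simpa using z1) (by simpa using z2)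
    (by rw [mul_div_r r0, e1]) (by rw [mul_div_r r0, e2]) (by rw [mul_div_r r0, e3])
    (by rw [mul_div_r r0, e4])
  rw [elog_coe (div_ne_zero n1 r0'), elog_coe (div_ne_zero n2 r0'), norm_div_r r0,
    norm_div_r r0] at this
  rw [one_mul, one_mul]
  exact_mod_cast this

lemma caseV {a b : ℂ} (ha : a ∈ unitDisc) (hb : b ∈ unitDisc) (hab : a ≠ b) (z : ℂ × ℂ) :
    limsup (fun ε => Leps4 a b ε z) (𝓝[≠] (0 : ℂ)) ≤ LaVb0 a b z := by
  refine le_sInf ?_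
  rintro t ⟨φ₁, φ₂, ζ₁, ζ₂, hd, m1, m2, z1, z2, e1, e2, e3, e4, d1, rfl⟩
  by_cases h0 : ζ₁ = 0 ∨ ζ₂ = 0
  · exact limsup_bot' ha hb z1 z2 e1 e2 e3 e4 h0 _
  push Not at h0
  obtain ⟨n1, n2⟩ := h0
  have n12 : ζ₁ ≠ ζ₂ := by
    rintro rfl
    exact hab (e1.symm.trans e3)
  rw [elog_coe n1, elog_coe n2, ← EReal.coe_add, ← EReal.coe_add]
  have key := shrink_limit (norm_ne_zero_iff.2 n1) (norm_ne_zero_iff.2 n2) (mem_unitDisc.1 m1)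
    (mem_unitDisc.1 m2) 2 1 (limsup (fun ε => Leps4 a b ε z) (𝓝[≠] (0 : ℂ))) ?_
  · simpa only [one_mul, two_mul] using key
  intro r r0 r1 hx hy
  have r0' : (r : ℂ) ≠ 0 := by exact_mod_cast r0.ne'
  have := coreV (z := z) (a := a) hb (StrictDisc.shrink hd.1 hd.2.2.1 r0 r1)
    (StrictDisc.shrink hd.2.1 hd.2.2.2 r0 r1) (div_r_mem r0 hx) (div_r_mem r0 hy)
    (div_ne_zero n1 r0') (div_ne_zero n2 r0') (div_r_inj r0 n12)
    (by simpa using z1) (by simpa using z2)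
    (by rw [mul_div_r r0, e1]) (by rw [mul_div_r r0, e2]) (by rw [mul_div_r r0, e3])
    (by rw [mul_div_r r0, e4]) (deriv_r r0 d1)
  rwa [norm_div_r r0, norm_div_r r0] at this

lemma caseVV {a b : ℂ} (ha : a ∈ unitDisc) (hb : b ∈ unitDisc) (hab : a ≠ b) (z : ℂ × ℂ) :
    limsup (fun ε => Leps4 a b ε z) (𝓝[≠] (0 : ℂ)) ≤ LaVbV a b z := by
  refine le_sInf ?_
  rintro t ⟨φ₁, φ₂, ζ₁, ζ₂, hd, m1, m2, z1, z2, e1, e2, e3, e4, d1, d2, rfl⟩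
  by_cases h0 : ζ₁ = 0 ∨ ζ₂ = 0
  · exact limsup_bot' ha hb z1 z2 e1 e2 e3 e4 h0 _
  push Not at h0
  obtain ⟨n1, n2⟩ := h0
  have n12 : ζ₁ ≠ ζ₂ := by
    rintro rfl
    exact hab (e1.symm.trans e3)
  rw [elog_coe n1, elog_coe n2, ← EReal.coe_add, ← EReal.coe_add, ← EReal.coe_add]
  have key := shrink_limit (norm_ne_zero_iff.2 n1) (norm_ne_zero_iff.2 n2) (mem_unitDisc.1 m1)
    (mem_unitDisc.1 m2) 2 2 (limsup (fun ε => Leps4 a b ε z) (𝓝[≠] (0 : ℂ))) ?_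
  · simpa only [two_mul, add_assoc] using key
  intro r r0 r1 hx hy
  have r0' : (r : ℂ) ≠ 0 := by exact_mod_cast r0.ne'
  have := coreVV (z := z) (a := a) (b := b) (StrictDisc.shrink hd.1 hd.2.2.1 r0 r1)
    (StrictDisc.shrink hd.2.1 hd.2.2.2 r0 r1) (div_r_mem r0 hx) (div_r_mem r0 hy)
    (div_ne_zero n1 r0') (div_ne_zero n2 r0') (div_r_inj r0 n12)
    (by simpa using z1) (by simpa using z2)
    (by rw [mul_div_r r0, e1]) (by rw [mul_div_r r0, e2]) (by rw [mul_div_r r0, e3])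
    (by rw [mul_div_r r0, e4]) (deriv_r r0 d1) (deriv_r r0 d2)
  rwa [norm_div_r r0, norm_div_r r0] at this

lemma LaVb0_le (a b : ℂ) (z : ℂ × ℂ) : LaVb0 b a z ≤ La0bV a b z := by
  refine le_sInf ?_
  rintro t ⟨φ₁, φ₂, ζ₁, ζ₂, hd, m1, m2, z1, z2, e1, e2, e3, e4, d1, rfl⟩
  refine sInf_le ⟨φ₁, φ₂, ζ₂, ζ₁, hd, m2, m1, z1, z2, e3, e4, e1, e2, d1, ?_⟩
  rw [add_comm (elog ‖ζ₁‖), add_right_comm]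

/-- Proposition `prop:limsupl4epsilon`:
`limsup_{ε→0, ε≠0} L^ε_{aVbV}(z) ≤ min {L_{a0b0}(z), L_{aVb0}(z), L_{a0bV}(z), L_{aVbV}(z)}`. -/
theorem limsup_Leps4_le_corrected
    (a b : ℂ) (ha : a ∈ unitDisc) (hb : b ∈ unitDisc) (hab : a ≠ b)
    (z : ℂ × ℂ) (hz1 : z.1 ∈ unitDisc) (hz2 : z.2 ∈ unitDisc) :
    Filter.limsup (fun ε => Leps4 a b ε z) (𝓝[≠] (0 : ℂ))
      ≤ min (min (La0b0 a b z) (LaVb0 a b z)) (min (La0bV a b z) (LaVbV a b z)) := by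
  refine le_min (le_min (case0 ha hb z) (caseV ha hb hab z)) (le_min ?_ (caseVV ha hb hab z))
  rw [Leps4_swap]
  exact (caseV hb ha hab.symm z).trans (LaVb0_le a b z)
end
end

section
/- Let a ∈ 𝔻 \ {0}, set b := −a, and let γ ∈ ℂ satisfy |a|^{3/2} < |γ| < |a|. Then liminf_{ε→0, ε≠0} L^ε_{aVbV}(0, γ) > 2·log|a|, where the liminf is over complex ε ≠ 0 tending to 0. (Here 2·log|a| = log|a| + log|b| is the limit as ε → 0 of the pluricomplex Green functions of 𝔻² with the four simple poles (a,0), (b,0), (b,ε), (a,ε), all weights 1, evaluated at (0,γ).) -/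
open Complex Metric Filter Topology

noncomputable section

/-- Holomorphic maps of the unit disc to the closed unit disc. -/
def SchurFn (f : ℂ → ℂ) : Prop :=
  DifferentiableOn ℂ f (ball 0 1) ∧ Set.MapsTo f (ball 0 1) (closedBall 0 1)

lemma mob_den_ne {w z : ℂ} (hw : ‖w‖ < 1) (hz : ‖z‖ ≤ 1) : 1 - (starRingEnd ℂ) w * z ≠ 0 := by
  intro h
  have h1 : (starRingEnd ℂ) w * z = 1 := (sub_eq_zero.mp h).symm
  have h2 : ‖w‖ * ‖z‖ = 1 := by
    rw [← Complex.norm_conj w, ← norm_mul, h1, norm_one]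
  nlinarith [norm_nonneg w, norm_nonneg z]

lemma mob_normSq (w z : ℂ) : Complex.normSq (1 - (starRingEnd ℂ) w * z) - Complex.normSq (w - z)
    = (1 - Complex.normSq w) * (1 - Complex.normSq z) := by
  simp [Complex.normSq_apply]
  ring

lemma mob_norm_le {w z : ℂ} (hw : ‖w‖ < 1) (hz : ‖z‖ ≤ 1) : ‖mobius w z‖ ≤ 1 := by
  have hd := mob_den_ne hw hz
  unfold mobius
  rw [norm_div, div_le_one (norm_pos_iff.mpr hd)]
  have h := mob_normSq w z
  simp only [Complex.normSq_eq_norm_sq] at h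
  refine le_of_sq_le_sq ?_ (norm_nonneg _)
  have h1 : 0 ≤ 1 - ‖w‖^2 := by nlinarith [norm_nonneg w]
  have h2 : 0 ≤ 1 - ‖z‖^2 := by nlinarith [norm_nonneg z]
  nlinarith [mul_nonneg h1 h2]

lemma mob_norm_lt {w z : ℂ} (hw : ‖w‖ < 1) (hz : ‖z‖ < 1) : ‖mobius w z‖ < 1 := by
  have hd := mob_den_ne hw hz.le
  unfold mobius
  rw [norm_div, div_lt_one (norm_pos_iff.mpr hd)]
  have h := mob_normSq w z
  simp only [Complex.normSq_eq_norm_sq] at h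
  refine lt_of_pow_lt_pow_left₀ 2 (norm_nonneg _) ?_
  have h1 : 0 < 1 - ‖w‖^2 := by nlinarith [norm_nonneg w]
  have h2 : 0 < 1 - ‖z‖^2 := by nlinarith [norm_nonneg z]
  nlinarith [mul_pos h1 h2]

lemma mob_self (w : ℂ) : mobius w w = 0 := by simp [mobius]
lemma mob_zero (w : ℂ) : mobius w 0 = w := by simp [mobius]

lemma mob_ne_zero {w z : ℂ} (hw : ‖w‖ < 1) (hz : ‖z‖ ≤ 1) (h : z ≠ w) : mobius w z ≠ 0 :=
  div_ne_zero (sub_ne_zero.mpr h.symm) (mob_den_ne hw hz)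

lemma mob_invol {w z : ℂ} (hw : ‖w‖ < 1) (hz : ‖z‖ < 1) : mobius w (mobius w z) = z := by
  have hd := mob_den_ne hw hz.le
  have hd2 := mob_den_ne hw (mob_norm_lt hw hz).le
  have hd3 := mob_den_ne hw hw.le
  have e2 : 1 - (starRingEnd ℂ) w * mobius w z
      = (1 - (starRingEnd ℂ) w * w) / (1 - (starRingEnd ℂ) w * z) := by
    unfold mobius; rw [eq_div_iff hd, sub_mul, mul_assoc, div_mul_cancel₀ _ hd]; ring
  have e1 : w - mobius w z = z * (1 - (starRingEnd ℂ) w * w) / (1 - (starRingEnd ℂ) w * z) := by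
    unfold mobius; rw [eq_div_iff hd, sub_mul, div_mul_cancel₀ _ hd]; ring
  rw [show mobius w (mobius w z) = (w - mobius w z) / (1 - (starRingEnd ℂ) w * mobius w z) from rfl,
    e1, e2, div_div_div_cancel_right₀ hd, mul_div_cancel_right₀ _ hd3]

lemma mob_hasDeriv {w z : ℂ} (hw : ‖w‖ < 1) (hz : ‖z‖ ≤ 1) :
    ∃ d : ℂ, d ≠ 0 ∧ HasDerivAt (mobius w) d z := by
  have hd := mob_den_ne hw hz
  have hd3 := mob_den_ne hw hw.le
  refine ⟨-(1 - (starRingEnd ℂ) w * w) / (1 - (starRingEnd ℂ) w * z) ^ 2,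
    div_ne_zero (neg_ne_zero.mpr hd3) (pow_ne_zero _ hd), ?_⟩
  have h1 : HasDerivAt (fun z : ℂ => w - z) (-1) z := by
    simpa using (hasDerivAt_id z).const_sub w
  have h2 : HasDerivAt (fun z : ℂ => 1 - (starRingEnd ℂ) w * z) (-(starRingEnd ℂ) w) z := by
    simpa using ((hasDerivAt_id z).const_mul ((starRingEnd ℂ) w)).const_sub 1
  have h3 := h1.div h2 hd
  have e : -(1 - (starRingEnd ℂ) w * w) = -1 * (1 - (starRingEnd ℂ) w * z)
      - (w - z) * -(starRingEnd ℂ) w := by ring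
  rw [e]
  exact h3

lemma schur_mob {w : ℂ} (hw : ‖w‖ < 1) : SchurFn (mobius w) := by
  constructor
  · intro z hz
    obtain ⟨d, -, h⟩ := mob_hasDeriv hw (mem_ball_zero_iff.mp hz).le
    exact h.differentiableAt.differentiableWithinAt
  · intro z hz
    simpa using mob_norm_le hw (mem_ball_zero_iff.mp hz).le

lemma schur_mob_comp {w : ℂ} (hw : ‖w‖ < 1) {f : ℂ → ℂ} (hf : SchurFn f) :
    SchurFn (fun z => mobius w (f z)) := by
  constructor
  · intro z hz
    obtain ⟨d, -, h⟩ := mob_hasDeriv hw (mem_closedBall_zero_iff.mp (hf.2 hz))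
    exact h.differentiableAt.comp_differentiableWithinAt z (hf.1 z hz)
  · intro z hz
    simpa using mob_norm_le hw (mem_closedBall_zero_iff.mp (hf.2 hz))

lemma schur_comp_mob {w : ℂ} (hw : ‖w‖ < 1) {f : ℂ → ℂ} (hf : SchurFn f) :
    SchurFn (fun z => f (mobius w z)) := by
  have hm : Set.MapsTo (mobius w) (ball 0 1) (ball 0 1) := by
    intro z hz
    simpa using mob_norm_lt hw (mem_ball_zero_iff.mp hz)
  exact ⟨hf.1.comp (schur_mob hw).1 hm, hf.2.comp hm⟩

lemma schur_fac0 {f : ℂ → ℂ} (hf : SchurFn f) (h0 : f 0 = 0) :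
    ∃ u, SchurFn u ∧ ∀ z, f z = z * u z := by
  refine ⟨dslope f 0, ⟨?_, ?_⟩, ?_⟩
  · exact (differentiableOn_dslope (ball_mem_nhds 0 one_pos)).mpr hf.1
  · intro z hz
    have := norm_dslope_le_div_of_mapsTo_ball (R₂ := 1) hf.1 (by rw [h0]; exact hf.2) hz
    simpa using this
  · intro z
    have := sub_smul_dslope f 0 z
    simpa [h0] using this.symm

lemma schur_fac {f : ℂ → ℂ} (hf : SchurFn f) {w : ℂ} (hw : ‖w‖ < 1) (h0 : f w = 0) :
    ∃ u, SchurFn u ∧ ∀ z ∈ ball (0:ℂ) 1, f z = mobius w z * u z := by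
  obtain ⟨u, hu, h⟩ := schur_fac0 (schur_comp_mob hw hf) (by rw [mob_zero, h0])
  refine ⟨_, schur_comp_mob hw hu, fun z hz => ?_⟩
  rw [← h, mob_invol hw (mem_ball_zero_iff.mp hz)]

lemma schur_const {u : ℂ → ℂ} (hu : SchurFn u) {w : ℂ} (hw : w ∈ ball (0:ℂ) 1) (h : ‖u w‖ = 1) :
    ∀ z ∈ ball (0:ℂ) 1, u z = u w := by
  have := Complex.eqOn_of_isPreconnected_of_isMaxOn_norm (f := u) (U := ball 0 1) (c := w)
    (convex_ball 0 1).isPreconnected isOpen_ball hu.1 hw (by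
      intro z hz
      simpa [h] using hu.2 hz)
  intro z hz
  simpa using this hz

lemma schur_double {f : ℂ → ℂ} {w : ℂ} (hw : ‖w‖ < 1) (h1 : deriv f w = 0)
    {u : ℂ → ℂ} (hu : SchurFn u) (h : ∀ z ∈ ball (0:ℂ) 1, f z = mobius w z * u z) : u w = 0 := by
  obtain ⟨d, hd, hm⟩ := mob_hasDeriv hw hw.le
  have hwb : ball (0:ℂ) 1 ∈ 𝓝 w := isOpen_ball.mem_nhds (by simpa using hw)
  have hu' := (hu.1.differentiableAt hwb).hasDerivAt
  have h2 := (hm.mul hu').congr_of_eventuallyEq (f₁ := f) (by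
    filter_upwards [hwb] with z hz using h z hz)
  have := h2.deriv
  rw [h1, mob_self] at this
  simpa [hd] using this.symm

lemma schur_zeros (s : Finset ℂ) : ∀ {f : ℂ → ℂ}, SchurFn f → (∀ x ∈ s, ‖x‖ < 1 ∧ f x = 0) →
    ‖f 0‖ ≤ ∏ x ∈ s, ‖x‖ := by
  induction s using Finset.induction_on with
  | empty => intro f hf _; simpa using hf.2 (mem_ball_self one_pos)
  | insert w s hw ih =>
    intro f hf hz
    obtain ⟨hw1, hfw⟩ := hz w (Finset.mem_insert_self _ _)
    obtain ⟨u, hu, h⟩ := schur_fac hf hw1 hfw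
    rw [Finset.prod_insert hw, h 0 (mem_ball_self one_pos), mob_zero, norm_mul]
    refine mul_le_mul_of_nonneg_left (ih hu fun x hx => ?_) (norm_nonneg _)
    obtain ⟨hx1, hfx⟩ := hz x (Finset.mem_insert_of_mem hx)
    refine ⟨hx1, ?_⟩
    rw [h x (by simpa using hx1)] at hfx
    refine (mul_eq_zero.mp hfx).resolve_left (mob_ne_zero hw1 hx1.le ?_)
    rintro rfl
    exact hw hx

/-- Boundary case. -/
lemma core_bd {f g : ℂ → ℂ} (hf : SchurFn f) (hg : SchurFn g) (f0 : f 0 = 0) {a b : ℂ} {r : ℝ}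
    (hr : 0 < r) (hr1 : r < 1) (har : ‖a‖ = r) (hbr : ‖b‖ = r) (hab : a ≠ b)
    (hγ : r * r < ‖g 0‖) {w x y : ℂ} (hw : ‖w‖ = r) (hfw : f w = a) (hgw : g w = 0)
    (hx : ‖x‖ ≤ 1) (hy : ‖y‖ ≤ 1) (hxy : ‖x‖ * ‖y‖ = r)
    (hx' : ‖x‖ < 1 → f x = b ∧ g x = 0) (hy' : ‖y‖ < 1 → f y = b ∧ g y = 0) : False := by
  obtain ⟨u, hu, h⟩ := schur_fac0 hf f0
  have hwb : w ∈ ball (0:ℂ) 1 := by simp [hw, hr1]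
  have huw : ‖u w‖ = 1 := by
    have := congrArg norm (h w)
    rw [hfw, norm_mul, har, hw] at this
    have h3 : r * ‖u w‖ = r * 1 := by linarith
    exact mul_left_cancel₀ hr.ne' h3
  have key : ∀ z, ‖z‖ < 1 → f z = b → ‖z‖ = r := by
    intro z hz hfz
    have := congrArg norm (h z)
    rw [hfz, norm_mul, schur_const hu hwb huw z (by simpa using hz), huw, hbr] at this
    linarith
  have key2 : ∀ z, ‖z‖ = r → f z = b → g z = 0 → False := by
    intro z hz hfz hgz
    have hne : w ≠ z := by
      rintro rfl; exact hab (hfw.symm.trans hfz)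
    have := schur_zeros {w, z} hg (by
      intro t ht
      simp only [Finset.mem_insert, Finset.mem_singleton] at ht
      rcases ht with rfl | rfl
      · exact ⟨by rw [hw]; exact hr1, hgw⟩
      · exact ⟨by rw [hz]; exact hr1, hgz⟩)
    rw [Finset.prod_pair hne, hw, hz] at this
    linarith
  rcases hx.lt_or_eq with hx1 | hx1
  · exact key2 x (key x hx1 (hx' hx1).1) (hx' hx1).1 (hx' hx1).2
  · rw [hx1, one_mul] at hxy
    have := hy' (by linarith)
    exact key2 y hxy this.1 this.2

/-- Both pairs coincide. -/
lemma core_dbl {f : ℂ → ℂ} (hf : SchurFn f) (f0 : f 0 = 0) {a b : ℂ} (ha : ‖a‖ < 1)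
    (ha0 : a ≠ 0)
    (hb : ‖b‖ < 1) (hab : b ≠ a) {w x : ℂ} (hw : ‖w‖ < 1) (hx : ‖x‖ < 1) (hwa : ‖w‖ * ‖w‖ = ‖a‖)
    (hfw : f w = a) (hfx : f x = b) (hw' : deriv f w = 0) (hx' : deriv f x = 0) : False := by
  have hF := schur_mob_comp ha hf
  have hder : ∀ z, ‖z‖ < 1 → deriv f z = 0 → deriv (fun z => mobius a (f z)) z = 0 := by
    intro z hz hz'
    have hzb : ball (0:ℂ) 1 ∈ 𝓝 z := isOpen_ball.mem_nhds (by simpa using hz)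
    have hd := (hf.1.differentiableAt hzb).hasDerivAt
    obtain ⟨d, -, hm⟩ := mob_hasDeriv ha
      (mem_closedBall_zero_iff.mp (hf.2 (mem_ball_zero_iff.mpr hz)))
    have := (hm.comp z hd).deriv
    rw [hz', mul_zero] at this
    exact this
  obtain ⟨u, hu, h⟩ := schur_fac hF hw (by simp only [hfw, mob_self])
  have huw := schur_double hw (hder w hw hw') hu h
  obtain ⟨v, hv, h2⟩ := schur_fac hu hw huw
  have hv0 : ‖v 0‖ = 1 := by
    have e := h 0 (mem_ball_self one_pos)
    rw [h2 0 (mem_ball_self one_pos), f0, mob_zero, mob_zero, ← mul_assoc] at e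
    have e2 := congrArg norm e
    rw [norm_mul, norm_mul, hwa] at e2
    have h3 : ‖a‖ * ‖v 0‖ = ‖a‖ * 1 := by linarith
    exact mul_left_cancel₀ (norm_ne_zero_iff.mpr ha0) h3
  have hvc := schur_const hv (mem_ball_self one_pos) hv0
  have hF2 : ∀ z ∈ ball (0:ℂ) 1, mobius a (f z) = mobius w z * mobius w z * v 0 := by
    intro z hz
    rw [h z hz, h2 z hz, hvc z hz, mul_assoc]
  obtain ⟨d, hd, hm⟩ := mob_hasDeriv hw hx.le
  have hxb : ball (0:ℂ) 1 ∈ 𝓝 x := isOpen_ball.mem_nhds (by simpa using hx)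
  have hD := ((hm.mul hm).mul_const (v 0)).congr_of_eventuallyEq (f₁ := fun z => mobius a (f z)) (by
    filter_upwards [hxb] with z hz using hF2 z hz)
  have e := hD.deriv
  rw [hder x hx hx'] at e
  have hv00 : v 0 ≠ 0 := by
    intro h; simp [h] at hv0
  have e2 : mobius w x = 0 := by
    have : (2 * d * v 0) * mobius w x = 0 := by linear_combination -e
    exact (mul_eq_zero.mp this).resolve_left (by simp [hd, hv00])
  have e3 := hF2 x (by simpa using hx)
  rw [e2, hfx] at e3
  exact mob_ne_zero ha hb.le hab (by simpa using e3)

lemma core {f g : ℂ → ℂ} (hf : SchurFn f) (hg : SchurFn g) (f0 : f 0 = 0) {a : ℂ} {s : ℝ}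
    (hs : 0 < s) (hs1 : s < 1) (has : ‖a‖ = s * s) (hγ : s * s * s < ‖g 0‖) {z1 z2 z3 z4 : ℂ}
    (n1 : ‖z1‖ ≤ 1) (n2 : ‖z2‖ ≤ 1) (n3 : ‖z3‖ ≤ 1) (n4 : ‖z4‖ ≤ 1)
    (h14 : ‖z1‖ * ‖z4‖ = s * s) (h23 : ‖z2‖ * ‖z3‖ = s * s)
    (p1 : ‖z1‖ < 1 → f z1 = a ∧ g z1 = 0) (p4 : ‖z4‖ < 1 → f z4 = a ∧ g z4 = 0)
    (p2 : ‖z2‖ < 1 → f z2 = -a ∧ g z2 = 0) (p3 : ‖z3‖ < 1 → f z3 = -a ∧ g z3 = 0)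
    (d14 : ‖z1‖ < 1 → z1 = z4 → deriv f z1 = 0) (d23 : ‖z2‖ < 1 → z2 = z3 → deriv f z2 = 0) :
    False := by
  have hr : 0 < s * s := by positivity
  have hr1 : s * s < 1 := by nlinarith
  have ha0 : a ≠ 0 := by rintro rfl; simp at has; exact hs.ne' has
  have hab : a ≠ -a := fun h => ha0 (self_eq_neg.mp h)
  have hna : ‖-a‖ = s * s := by rw [norm_neg, has]
  have hγ2 : (s * s) * (s * s) < ‖g 0‖ := by
    refine lt_of_le_of_lt ?_ hγ
    nlinarith [mul_pos hr hs]
  rcases n1.lt_or_eq with l1 | l1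
  swap
  · rw [l1, one_mul] at h14
    obtain ⟨q, q'⟩ := p4 (by linarith)
    exact core_bd hf hg f0 hr hr1 has hna hab hγ2 h14 q q' n2 n3 h23 p2 p3
  rcases n4.lt_or_eq with l4 | l4
  swap
  · rw [l4, mul_one] at h14
    obtain ⟨q, q'⟩ := p1 (by linarith)
    exact core_bd hf hg f0 hr hr1 has hna hab hγ2 h14 q q' n2 n3 h23 p2 p3
  rcases n2.lt_or_eq with l2 | l2
  swap
  · rw [l2, one_mul] at h23
    obtain ⟨q, q'⟩ := p3 (by linarith)
    exact core_bd hf hg f0 hr hr1 hna has hab.symm hγ2 h23 q q' n1 n4 h14 p1 p4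
  rcases n3.lt_or_eq with l3 | l3
  swap
  · rw [l3, mul_one] at h23
    obtain ⟨q, q'⟩ := p2 (by linarith)
    exact core_bd hf hg f0 hr hr1 hna has hab.symm hγ2 h23 q q' n1 n4 h14 p1 p4
  obtain ⟨f1, g1⟩ := p1 l1
  obtain ⟨f2, g2⟩ := p2 l2
  obtain ⟨f3, g3⟩ := p3 l3
  obtain ⟨f4, g4⟩ := p4 l4
  have ne12 : z1 ≠ z2 := by rintro rfl; exact hab (f1.symm.trans f2)
  have ne13 : z1 ≠ z3 := by rintro rfl; exact hab (f1.symm.trans f3)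
  have ne42 : z4 ≠ z2 := by rintro rfl; exact hab (f4.symm.trans f2)
  have ne43 : z4 ≠ z3 := by rintro rfl; exact hab (f4.symm.trans f3)
  by_cases e14 : z1 = z4
  · subst e14
    have hz1 : ‖z1‖ = s := by nlinarith [norm_nonneg z1]
    by_cases e23 : z2 = z3
    · subst e23
      exact core_dbl hf f0 (by linarith) ha0 (by linarith) hab.symm l1 l2
        (by rw [h14, has]) f1 f2 (d14 l1 rfl) (d23 l2 rfl)
    · have := schur_zeros {z1, z2, z3} hg (by
        intro t ht
        simp only [Finset.mem_insert, Finset.mem_singleton] at ht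
        rcases ht with rfl | rfl | rfl
        exacts [⟨l1, g1⟩, ⟨l2, g2⟩, ⟨l3, g3⟩])
      rw [Finset.prod_insert (by simp [ne12, ne13]), Finset.prod_pair e23, h23, hz1] at this
      linarith
  · by_cases e23 : z2 = z3
    · subst e23
      have hz2 : ‖z2‖ = s := by nlinarith [norm_nonneg z2]
      have := schur_zeros {z2, z1, z4} hg (by
        intro t ht
        simp only [Finset.mem_insert, Finset.mem_singleton] at ht
        rcases ht with rfl | rfl | rfl
        exacts [⟨l2, g2⟩, ⟨l1, g1⟩, ⟨l4, g4⟩])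
      rw [Finset.prod_insert (by simp [ne12.symm, ne42.symm]), Finset.prod_pair e14, h14, hz2] at this
      linarith
    · have := schur_zeros {z1, z4, z2, z3} hg (by
        intro t ht
        simp only [Finset.mem_insert, Finset.mem_singleton] at ht
        rcases ht with rfl | rfl | rfl | rfl
        exacts [⟨l1, g1⟩, ⟨l4, g4⟩, ⟨l2, g2⟩, ⟨l3, g3⟩])
      rw [Finset.prod_insert (by simp [ne12, ne13, e14]), Finset.prod_insert (by simp [ne42, ne43]),
        Finset.prod_pair e23, h23, ← mul_assoc, h14] at this
      linarith

/-- Montel along an ultrafilter. -/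
lemma montel {φ : ℕ → ℂ → ℂ} (hφ : ∀ n, SchurFn (φ n)) (U : Ultrafilter ℕ) :
    ∃ f, SchurFn f ∧ TendstoLocallyUniformlyOn φ f U (ball 0 1) := by
  have hlim : ∀ z, ∃ l : ℂ, z ∈ ball (0:ℂ) 1 →
      l ∈ closedBall (0:ℂ) 1 ∧ Tendsto (fun n => φ n z) U (𝓝 l) := by
    intro z
    by_cases hz : z ∈ ball (0:ℂ) 1
    · obtain ⟨l, hl, h⟩ := (isCompact_closedBall (0:ℂ) 1).ultrafilter_le_nhds
        (U.map fun n => φ n z) (by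
          simp only [Ultrafilter.coe_map, le_principal_iff]
          exact (Filter.Eventually.of_forall fun n => (hφ n).2 hz :
            ∀ᶠ n in (U : Filter ℕ), φ n z ∈ closedBall (0:ℂ) 1))
      exact ⟨l, fun _ => ⟨hl, h⟩⟩
    · exact ⟨0, fun h => absurd h hz⟩
  choose f hf using hlim
  have hT : TendstoLocallyUniformlyOn φ f U (ball 0 1) := by
    rw [Metric.tendstoLocallyUniformlyOn_iff]
    intro ε hε x hx
    have hx1 : ‖x‖ < 1 := mem_ball_zero_iff.mp hx
    set R := 1 - ‖x‖ with hR
    have hR0 : 0 < R := by linarith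
    have hsub : ball x R ⊆ ball 0 1 := ball_subset_ball' (by simp [hR])
    have hlip : ∀ n, ∀ y ∈ ball x R, dist (φ n y) (φ n x) ≤ 2 / R * dist y x := by
      intro n y hy
      refine dist_le_div_mul_dist_of_mapsTo_ball ((hφ n).1.mono hsub) ?_ hy
      intro t ht
      have h1 := mem_closedBall_zero_iff.mp ((hφ n).2 (hsub ht))
      have h2 := mem_closedBall_zero_iff.mp ((hφ n).2 hx)
      rw [mem_closedBall, dist_eq_norm]
      exact (norm_sub_le _ _).trans (by linarith)
    have hlipf : ∀ y ∈ ball x R, dist (f y) (f x) ≤ 2 / R * dist y x := by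
      intro y hy
      exact le_of_tendsto (((hf y (hsub hy)).2).dist ((hf x hx).2))
        (Filter.Eventually.of_forall fun n => hlip n y hy)
    have hδ : 0 < min R (R * ε / 6) := lt_min hR0 (by positivity)
    refine ⟨ball x (min R (R * ε / 6)), mem_nhdsWithin_of_mem_nhds (ball_mem_nhds x hδ), ?_⟩
    have hev := Metric.tendsto_nhds.mp (hf x hx).2 (ε / 3) (by positivity)
    filter_upwards [hev] with n hn y hy
    have hyR : y ∈ ball x R := ball_subset_ball (min_le_left _ _) hy
    have hb : 2 / R * dist y x < ε / 3 := by
      have : dist y x < R * ε / 6 := lt_of_lt_of_le (mem_ball.mp hy) (min_le_right _ _)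
      calc 2 / R * dist y x < 2 / R * (R * ε / 6) := by gcongr
        _ = ε / 3 := by field_simp; norm_num
    have h1 := hlip n y hyR
    have h2 := hlipf y hyR
    have h3 := dist_triangle4 (f y) (f x) (φ n x) (φ n y)
    rw [dist_comm (f x), dist_comm (φ n x) (φ n y)] at h3
    linarith
  refine ⟨f, ⟨hT.differentiableOn (Filter.Eventually.of_forall fun n => (hφ n).1) isOpen_ball,
    fun z hz => (hf z hz).1⟩, hT⟩

lemma lim_val {φ : ℕ → ℂ → ℂ} {f : ℂ → ℂ} (hf : SchurFn f) {U : Ultrafilter ℕ}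
    (hT : TendstoLocallyUniformlyOn φ f U (ball 0 1)) {x : ℕ → ℂ} {z : ℂ} (hz : ‖z‖ < 1)
    (hx : Tendsto x U (𝓝 z)) : Tendsto (fun n => φ n (x n)) U (𝓝 (f z)) := by
  have hzb : ball (0:ℂ) 1 ∈ 𝓝 z := isOpen_ball.mem_nhds (by simpa using hz)
  refine tendsto_comp_of_locally_uniform_limit (hf.1.continuousOn.continuousAt hzb) hx ?_
  intro u hu
  obtain ⟨t, ht, h⟩ := hT u hu z (by simpa using hz)
  rw [isOpen_ball.nhdsWithin_eq (by simpa using hz)] at ht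
  exact ⟨t, ht, h⟩

lemma lim_deriv {φ : ℕ → ℂ → ℂ} {f : ℂ → ℂ} (hφ : ∀ n, SchurFn (φ n)) (hf : SchurFn f)
    {U : Ultrafilter ℕ}
    (hT : TendstoLocallyUniformlyOn φ f U (ball 0 1)) {x y : ℕ → ℂ} {z : ℂ} (hz : ‖z‖ < 1)
    (hx : Tendsto x U (𝓝 z)) (hy : Tendsto y U (𝓝 z)) (hne : ∀ n, x n ≠ y n)
    (he : ∀ n, φ n (x n) = φ n (y n)) : deriv f z = 0 := by
  have hzb : z ∈ ball (0:ℂ) 1 := by simpa using hz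
  have hD := hT.deriv (Filter.Eventually.of_forall fun n => (hφ n).1) isOpen_ball
  have hc : ContinuousAt (deriv f) z :=
    (hf.1.deriv isOpen_ball).continuousOn.continuousAt (isOpen_ball.mem_nhds hzb)
  by_contra hne0
  have hpos : 0 < ‖deriv f z‖ := norm_pos_iff.mpr hne0
  set c := ‖deriv f z‖ / 3 with hcdef
  have hc0 : 0 < c := by positivity
  rw [Metric.tendstoLocallyUniformlyOn_iff] at hD
  obtain ⟨t, ht, hev⟩ := hD c hc0 z hzb
  rw [isOpen_ball.nhdsWithin_eq hzb] at ht
  have ht2 : t ∩ ball 0 1 ∩ {w | dist (deriv f w) (deriv f z) < c} ∈ 𝓝 z :=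
    inter_mem (inter_mem ht (isOpen_ball.mem_nhds hzb)) (Metric.tendsto_nhds.mp hc c hc0)
  obtain ⟨δ, hδ, hsub⟩ := Metric.mem_nhds_iff.mp ht2
  obtain ⟨n, h1, h2, h3⟩ := (hev.and ((hx.eventually (ball_mem_nhds z hδ)).and
    (hy.eventually (ball_mem_nhds z hδ)))).exists
  have hdif : ∀ w ∈ ball z δ, HasDerivWithinAt (fun w => φ n w - deriv f z * w)
      (deriv (φ n) w - deriv f z) (ball z δ) w := by
    intro w hw
    have hd := ((hφ n).1.differentiableAt (isOpen_ball.mem_nhds (hsub hw).1.2)).hasDerivAt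
    have h5 : HasDerivAt (fun w => deriv f z * w) (deriv f z) w := by
      simpa using (hasDerivAt_id w).const_mul (deriv f z)
    exact (hd.sub h5).hasDerivWithinAt
  have hb : ∀ w ∈ ball z δ, ‖deriv (φ n) w - deriv f z‖ ≤ 2 * c := by
    intro w hw
    have a1 := h1 w (hsub hw).1.1
    have a2 : dist (deriv f w) (deriv f z) < c := (hsub hw).2
    have a3 := dist_triangle (deriv (φ n) w) (deriv f w) (deriv f z)
    rw [dist_comm] at a1
    simp only [Function.comp_apply] at a1
    rw [← dist_eq_norm]
    linarith
  have := (convex_ball z δ).norm_image_sub_le_of_norm_hasDerivWithin_le hdif hb h3 h2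
  have e : φ n (x n) - deriv f z * x n - (φ n (y n) - deriv f z * y n)
      = - (deriv f z * (x n - y n)) := by rw [he n]; ring
  rw [e, norm_neg, norm_mul] at this
  have hp : 0 < ‖x n - y n‖ := norm_pos_iff.mpr (sub_ne_zero.mpr (hne n))
  have h4 := le_of_mul_le_mul_right this hp
  linarith

lemma elog_of_ne {z : ℂ} (h : z ≠ 0) : elog ‖z‖ = ((Real.log ‖z‖ : ℝ) : EReal) := by
  simp [elog, h]

lemma ultra_lim (U : Ultrafilter ℕ) {x : ℕ → ℂ} (hx : ∀ n, x n ∈ ball (0:ℂ) 1) :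
    ∃ z, ‖z‖ ≤ 1 ∧ Tendsto x U (𝓝 z) := by
  obtain ⟨l, hl, h⟩ := (isCompact_closedBall (0:ℂ) 1).ultrafilter_le_nhds (U.map x) (by
    simp only [Ultrafilter.coe_map, le_principal_iff]
    exact (Filter.Eventually.of_forall fun n => ball_subset_closedBall (hx n) :
            ∀ᶠ n in (U : Filter ℕ), x n ∈ closedBall (0:ℂ) 1))
  exact ⟨l, by simpa using hl, h⟩

/-- Two distinct preimages of `a`. -/
lemma two_pre {f : ℂ → ℂ} (hf : SchurFn f) (f0 : f 0 = 0) {a x y : ℂ} (ha : ‖a‖ < 1)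
    (hx : ‖x‖ < 1) (hy : ‖y‖ < 1) (hxy : x ≠ y) (fx : f x = a) (fy : f y = a) :
    ‖a‖ ≤ ‖x‖ * ‖y‖ := by
  have := schur_zeros {x, y} (schur_mob_comp ha hf) (by
    intro t ht
    simp only [Finset.mem_insert, Finset.mem_singleton] at ht
    rcases ht with rfl | rfl
    · exact ⟨hx, by simp only [fx, mob_self]⟩
    · exact ⟨hy, by simp only [fy, mob_self]⟩)
  rwa [Finset.prod_pair hxy, f0, mob_zero] at this

/-- From Theorem `NoComan`: with `b = -a` and `|a|^{3/2} < |γ| < |a|`,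
`liminf_{ε→0, ε≠0} L^ε_{aVbV}(0,γ) > 2 log|a| = G_{aVbV}(0,γ)`. -/
theorem liminf_Leps4_gt_green
    (a γ : ℂ) (ha : a ∈ unitDisc) (ha0 : a ≠ 0)
    (h1 : (‖a‖) ^ ((3 : ℝ) / 2) < ‖γ‖)
    (h2 : ‖γ‖ < ‖a‖) :
    ((2 * Real.log (‖a‖) : ℝ) : EReal)
      < Filter.liminf (fun ε => Leps4 a (-a) ε (0, γ)) (𝓝[≠] (0 : ℂ)) := by
  by_contra hcon
  rw [not_lt] at hcon
  have ha1 : ‖a‖ < 1 := mem_ball_zero_iff.mp ha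
  have hr : 0 < ‖a‖ := norm_pos_iff.mpr ha0
  have hab : a ≠ -a := fun h => ha0 (self_eq_neg.mp h)
  have hseq : ∀ n : ℕ, ∃ (ε : ℂ) (φ₁ φ₂ : ℂ → ℂ) (ζ₁ ζ₂ ζ₃ ζ₄ : ℂ),
      ε ≠ 0 ∧ ‖ε‖ < 1 / ((n : ℝ) + 1) ∧ SchurFn φ₁ ∧ SchurFn φ₂ ∧
      ζ₁ ∈ ball (0:ℂ) 1 ∧ ζ₂ ∈ ball (0:ℂ) 1 ∧ ζ₃ ∈ ball (0:ℂ) 1 ∧ ζ₄ ∈ ball (0:ℂ) 1 ∧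
      φ₁ 0 = 0 ∧ φ₂ 0 = γ ∧
      φ₁ ζ₁ = a ∧ φ₂ ζ₁ = 0 ∧ φ₁ ζ₂ = -a ∧ φ₂ ζ₂ = 0 ∧
      φ₁ ζ₃ = -a ∧ φ₂ ζ₃ = ε ∧ φ₁ ζ₄ = a ∧ φ₂ ζ₄ = ε ∧
      (‖ζ₁‖ * ‖ζ₄‖) * (‖ζ₂‖ * ‖ζ₃‖) ≤ ‖a‖ * ‖a‖ * Real.exp (1 / ((n : ℝ) + 1)) := by
    intro n
    have hn : (0 : ℝ) < 1 / ((n : ℝ) + 1) := by positivity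
    have hlt : Filter.liminf (fun ε => Leps4 a (-a) ε (0, γ)) (𝓝[≠] (0 : ℂ))
        < ((2 * Real.log ‖a‖ + 1 / ((n : ℝ) + 1) : ℝ) : EReal) :=
      lt_of_le_of_lt hcon (EReal.coe_lt_coe_iff.mpr (by linarith))
    have hfr := Filter.frequently_lt_of_liminf_lt (by isBoundedDefault) hlt
    have hev : ∀ᶠ ε : ℂ in 𝓝[≠] 0, ε ≠ 0 ∧ ‖ε‖ < 1 / ((n : ℝ) + 1) := by
      refine (eventually_mem_nhdsWithin).and (mem_nhdsWithin_of_mem_nhds ?_)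
      filter_upwards [ball_mem_nhds (0:ℂ) hn] with z hz
      simpa using hz
    obtain ⟨ε, hε, hε0, hε1⟩ := (hfr.and_eventually hev).exists
    obtain ⟨t, ⟨φ₁, φ₂, ζ₁, ζ₂, ζ₃, ζ₄, ⟨d1, d2, m1, m2⟩, z1, z2, z3, z4, e10, e20,
      e11, e21, e12, e22, e13, e23, e14, e24, rfl⟩, ht⟩ := sInf_lt_iff.mp hε
    refine ⟨ε, φ₁, φ₂, ζ₁, ζ₂, ζ₃, ζ₄, hε0, hε1,
      ⟨d1, fun w hw => ball_subset_closedBall (m1 w hw)⟩,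
      ⟨d2, fun w hw => ball_subset_closedBall (m2 w hw)⟩, z1, z2, z3, z4, e10, e20,
      e11, e21, e12, e22, e13, e23, e14, e24, ?_⟩
    have n1 : ζ₁ ≠ 0 := by rintro rfl; exact ha0 (e11.symm.trans e10)
    have n4 : ζ₄ ≠ 0 := by rintro rfl; exact ha0 (e14.symm.trans e10)
    have n2 : ζ₂ ≠ 0 := by rintro rfl; exact neg_ne_zero.mpr ha0 (e12.symm.trans e10)
    have n3 : ζ₃ ≠ 0 := by rintro rfl; exact neg_ne_zero.mpr ha0 (e13.symm.trans e10)
    rw [elog_of_ne n1, elog_of_ne n2, elog_of_ne n3, elog_of_ne n4] at ht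
    have ht' : Real.log ‖ζ₁‖ + Real.log ‖ζ₂‖ + Real.log ‖ζ₃‖ + Real.log ‖ζ₄‖
        < 2 * Real.log ‖a‖ + 1 / ((n : ℝ) + 1) := by exact_mod_cast ht
    have p1 := norm_pos_iff.mpr n1
    have p2 := norm_pos_iff.mpr n2
    have p3 := norm_pos_iff.mpr n3
    have p4 := norm_pos_iff.mpr n4
    rw [← Real.log_le_log_iff (by positivity) (by positivity),
      Real.log_mul (by positivity) (by positivity), Real.log_mul p1.ne' p4.ne',
      Real.log_mul p2.ne' p3.ne', Real.log_mul (by positivity) (by positivity),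
      Real.log_mul hr.ne' hr.ne', Real.log_exp]
    linarith
  choose ε φ ψ x1 x2 x3 x4 hε0 hε1 hφ hψ b1 b2 b3 b4 e10 e20 e11 e21 e12 e22 e13 e23 e14 e24 hp
    using hseq
  let U : Ultrafilter ℕ := Ultrafilter.of atTop
  have hU : (U : Filter ℕ) ≤ atTop := Ultrafilter.of_le atTop
  obtain ⟨f, hf, hfT⟩ := montel hφ U
  obtain ⟨g, hg, hgT⟩ := montel hψ U
  obtain ⟨z1, n1, t1⟩ := ultra_lim U b1
  obtain ⟨z2, n2, t2⟩ := ultra_lim U b2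
  obtain ⟨z3, n3, t3⟩ := ultra_lim U b3
  obtain ⟨z4, n4, t4⟩ := ultra_lim U b4
  have hinv : Tendsto (fun n : ℕ => 1 / ((n : ℝ) + 1)) U (𝓝 0) :=
    tendsto_one_div_add_atTop_nhds_zero_nat.mono_left hU
  have hε : Tendsto ε U (𝓝 0) := squeeze_zero_norm (fun n => (hε1 n).le) hinv
  have f0 : f 0 = 0 := by
    refine tendsto_nhds_unique (lim_val hf hfT (x := fun _ => 0) (by simp) tendsto_const_nhds) ?_
    simp only [e10]; exact tendsto_const_nhds
  have g0 : g 0 = γ := by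
    refine tendsto_nhds_unique (lim_val hg hgT (x := fun _ => 0) (by simp) tendsto_const_nhds) ?_
    simp only [e20]; exact tendsto_const_nhds
  have ne14 : ∀ n, x1 n ≠ x4 n := by
    intro n h
    apply hε0 n
    rw [← e24 n, ← h, e21 n]
  have ne23 : ∀ n, x2 n ≠ x3 n := by
    intro n h
    apply hε0 n
    rw [← e23 n, ← h, e22 n]
  have nb : ∀ {z : ℂ}, z ∈ ball (0:ℂ) 1 → ‖z‖ < 1 := fun h => mem_ball_zero_iff.mp h
  have l14 : ∀ n, ‖a‖ ≤ ‖x1 n‖ * ‖x4 n‖ := fun n =>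
    two_pre (hφ n) (e10 n) ha1 (nb (b1 n)) (nb (b4 n)) (ne14 n) (e11 n) (e14 n)
  have l23 : ∀ n, ‖a‖ ≤ ‖x2 n‖ * ‖x3 n‖ := fun n => by
    rw [← norm_neg a]
    exact two_pre (hφ n) (e10 n) (by rwa [norm_neg]) (nb (b2 n)) (nb (b3 n)) (ne23 n)
      (e12 n) (e13 n)
  have T14 := t1.norm.mul t4.norm
  have T23 := t2.norm.mul t3.norm
  have L14 : ‖a‖ ≤ ‖z1‖ * ‖z4‖ := ge_of_tendsto T14 (Filter.Eventually.of_forall l14)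
  have L23 : ‖a‖ ≤ ‖z2‖ * ‖z3‖ := ge_of_tendsto T23 (Filter.Eventually.of_forall l23)
  have LP : (‖z1‖ * ‖z4‖) * (‖z2‖ * ‖z3‖) ≤ ‖a‖ * ‖a‖ := by
    have hR : Tendsto (fun n : ℕ => ‖a‖ * ‖a‖ * Real.exp (1 / ((n : ℝ) + 1))) U
        (𝓝 (‖a‖ * ‖a‖)) := by
      have := ((Real.continuous_exp.tendsto 0).comp hinv).const_mul (‖a‖ * ‖a‖)
      simpa using this
    exact le_of_tendsto_of_tendsto (T14.mul T23) hR (Filter.Eventually.of_forall hp)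
  have E14 : ‖z1‖ * ‖z4‖ = ‖a‖ := by nlinarith
  have E23 : ‖z2‖ * ‖z3‖ = ‖a‖ := by nlinarith
  have hss : ‖a‖ = Real.sqrt ‖a‖ * Real.sqrt ‖a‖ := (Real.mul_self_sqrt hr.le).symm
  have hs0 : 0 < Real.sqrt ‖a‖ := Real.sqrt_pos.mpr hr
  have hs1 : Real.sqrt ‖a‖ < 1 := by
    rw [Real.sqrt_lt' one_pos]; simpa using ha1
  have hγ : Real.sqrt ‖a‖ * Real.sqrt ‖a‖ * Real.sqrt ‖a‖ < ‖g 0‖ := by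
    rw [← hss, g0]
    have : ‖a‖ ^ ((3 : ℝ) / 2) = ‖a‖ * Real.sqrt ‖a‖ := by
      rw [show (3 : ℝ) / 2 = 1 + 1 / 2 by norm_num, Real.rpow_add hr, Real.rpow_one,
        Real.sqrt_eq_rpow]
    rwa [this] at h1
  have val : ∀ {x : ℕ → ℂ} {z c : ℂ}, Tendsto x U (𝓝 z) → (∀ n, φ n (x n) = c) → ‖z‖ < 1 →
      f z = c := by
    intro x z c hx hc hz
    refine tendsto_nhds_unique (lim_val hf hfT hz hx) ?_
    simp only [hc]; exact tendsto_const_nhds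
  have val0 : ∀ {x : ℕ → ℂ} {z : ℂ}, Tendsto x U (𝓝 z) → (∀ n, ψ n (x n) = 0) → ‖z‖ < 1 →
      g z = 0 := by
    intro x z hx hc hz
    refine tendsto_nhds_unique (lim_val hg hgT hz hx) ?_
    simp only [hc]; exact tendsto_const_nhds
  have vale : ∀ {x : ℕ → ℂ} {z : ℂ}, Tendsto x U (𝓝 z) → (∀ n, ψ n (x n) = ε n) → ‖z‖ < 1 →
      g z = 0 := by
    intro x z hx hc hz
    refine tendsto_nhds_unique (lim_val hg hgT hz hx) ?_
    simp only [hc]; exact hε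
  exact core hf hg f0 hs0 hs1 hss hγ n1 n2 n3 n4 (E14.trans hss) (E23.trans hss)
    (fun h => ⟨val t1 e11 h, val0 t1 e21 h⟩) (fun h => ⟨val t4 e14 h, vale t4 e24 h⟩)
    (fun h => ⟨val t2 e12 h, val0 t2 e22 h⟩) (fun h => ⟨val t3 e13 h, vale t3 e23 h⟩)
    (fun h e => lim_deriv hφ hf hfT h t1 (e ▸ t4) ne14 (fun n => (e11 n).trans (e14 n).symm))
    (fun h e => lim_deriv hφ hf hfT h t2 (e ▸ t3) ne23 (fun n => (e12 n).trans (e13 n).symm))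
end
end
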